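/- arXiv:math/0503367 — 2 statements merged into one kernel-verified Lean document; each statement's English description precedes it below -/
import Mathlib

section
/- Let k ≥ 2 be an integer and α ∈ ℝ be irrational, and let S_k = {n ∈ ℕ : {nᵏα} ∈ [1/4, 3/4]}, where {x} denotes the fractional part of x. Then S_k is a set of (k−1)-recurrence for commuting transformations: whenever T₁, …, T_{k−1} are pairwise commuting measure-preserving transformations of a probability space (X, 𝒳, μ) and A ∈ 𝒳 with μ(A) > 0, there exists n ∈ S_k such that μ(A ∩ T₁⁻ⁿA ∩ ⋯ ∩ T_{k−1}⁻ⁿA) > 0. -/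
open MeasureTheory

section Average

open scoped BigOperators

/-- The average of a real-valued function over a finite type. -/
noncomputable def avg {Ω : Type*} [Finite Ω] (f : Ω → ℝ) : ℝ :=
  letI := Fintype.ofFinite Ω
  𝔼 ω, f ω

/-- The density of a set in a finite type. -/
noncomputable def dens {Ω : Type*} [Finite Ω] (A : Set Ω) : ℝ := avg (A.indicator 1)

variable {Ω Ω' : Type*} [Finite Ω] [Finite Ω']

lemma avg_eq_expect [Fintype Ω] (f : Ω → ℝ) : avg f = 𝔼 ω, f ω := by
  unfold avg
  congr!

lemma avg_add (f g : Ω → ℝ) : avg (fun ω => f ω + g ω) = avg f + avg g :=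
  Finset.expect_add_distrib _ _ _

lemma avg_sub (f g : Ω → ℝ) : avg (fun ω => f ω - g ω) = avg f - avg g :=
  Finset.expect_sub_distrib _ _ _

lemma avg_const_mul (c : ℝ) (f : Ω → ℝ) : avg (fun ω => c * f ω) = c * avg f :=
  (Finset.mul_expect _ _ _).symm

lemma avg_const [Nonempty Ω] (c : ℝ) : avg (fun _ : Ω => c) = c := by
  cases nonempty_fintype Ω
  rw [avg_eq_expect, Fintype.expect_const]

lemma avg_finset_sum {Λ : Type*} (s : Finset Λ) (f : Λ → Ω → ℝ) :
    avg (fun ω => ∑ l ∈ s, f l ω) = ∑ l ∈ s, avg (f l) :=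
  Finset.expect_sum_comm _ _ _

lemma avg_mono {f g : Ω → ℝ} (h : ∀ ω, f ω ≤ g ω) : avg f ≤ avg g :=
  Finset.expect_le_expect fun ω _ => h ω

lemma avg_le [Nonempty Ω] {f : Ω → ℝ} {c : ℝ} (h : ∀ ω, f ω ≤ c) : avg f ≤ c :=
  (avg_mono h).trans_eq (avg_const c)

lemma le_avg [Nonempty Ω] {f : Ω → ℝ} {c : ℝ} (h : ∀ ω, c ≤ f ω) : c ≤ avg f :=
  (avg_const c).symm.trans_le (avg_mono h)

lemma exists_avg_le [Nonempty Ω] (f : Ω → ℝ) : ∃ ω, avg f ≤ f ω := by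
  by_contra! h
  cases nonempty_fintype Ω
  obtain ⟨ω, hω⟩ := Finite.exists_max f
  exact absurd (avg_le hω) (not_le.2 (h ω))

lemma avg_comp_equiv (e : Ω ≃ Ω') (f : Ω' → ℝ) : avg (fun ω => f (e ω)) = avg f := by
  cases nonempty_fintype Ω
  cases nonempty_fintype Ω'
  rw [avg_eq_expect, avg_eq_expect]
  exact Fintype.expect_equiv e _ _ fun _ => rfl

lemma avg_comm (f : Ω → Ω' → ℝ) :
    avg (fun ω => avg (fun ω' => f ω ω')) = avg (fun ω' => avg (fun ω => f ω ω')) :=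
  Finset.expect_comm _ _ _

lemma avg_prod (f : Ω × Ω' → ℝ) : avg f = avg (fun ω => avg (fun ω' => f (ω, ω'))) := by
  cases nonempty_fintype Ω
  cases nonempty_fintype Ω'
  simp only [avg_eq_expect]
  exact Finset.expect_product _ _ _

lemma avg_unique [Unique Ω] (f : Ω → ℝ) : avg f = f default := by
  have : f = fun _ => f default := funext fun ω => by rw [Subsingleton.elim ω default]
  rw [this, avg_const]

lemma avg_eq_sum_div [Fintype Ω] (f : Ω → ℝ) : avg f = (∑ ω, f ω) / Nat.card Ω := by
  rw [avg_eq_expect, Fintype.expect_eq_sum_div_card, Nat.card_eq_fintype_card]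

/-- The average of a function supported on the range of an injection. -/
lemma avg_indicator_range {g : Ω' → Ω} (hg : g.Injective) (f : Ω → ℝ) :
    avg ((Set.range g).indicator f) = Nat.card Ω' / Nat.card Ω * avg (fun ω' => f (g ω')) := by
  classical
  cases nonempty_fintype Ω
  cases nonempty_fintype Ω'
  rw [avg_eq_sum_div, avg_eq_sum_div]
  have : ∑ ω, (Set.range g).indicator f ω = ∑ ω', f (g ω') := by
    rw [Finset.sum_indicator_eq_sum_filter]
    have : Finset.univ.filter (fun ω => ω ∈ Set.range g) = Finset.univ.image g := by
      ext; simp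
    rw [this, Finset.sum_image fun _ _ _ _ h => hg h]
  rw [this]
  rcases isEmpty_or_nonempty Ω' with h | h
  · simp
  · have : (Nat.card Ω' : ℝ) ≠ 0 := by simp [Nat.card_eq_fintype_card, Fintype.card_ne_zero]
    field_simp

lemma avg_option (f : Option Ω → ℝ) :
    avg f = (f none + Nat.card Ω * avg (fun a => f (some a))) / (Nat.card Ω + 1) := by
  cases nonempty_fintype Ω
  rw [avg_eq_sum_div, avg_eq_sum_div, Fintype.sum_option]
  rcases isEmpty_or_nonempty Ω with h | h
  · simp
  · have : (Nat.card Ω : ℝ) ≠ 0 := by simp [Nat.card_eq_fintype_card, Fintype.card_ne_zero]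
    rw [mul_div_cancel₀ _ this]
    simp

lemma dens_nonneg (A : Set Ω) : 0 ≤ dens A :=
  Finset.expect_nonneg fun _ _ => Set.indicator_nonneg (by simp) _

lemma dens_mono {A B : Set Ω} (h : A ⊆ B) : dens A ≤ dens B :=
  avg_mono fun ω => Set.indicator_le_indicator_of_subset h (by simp) ω

lemma dens_univ [Nonempty Ω] : dens (Set.univ : Set Ω) = 1 := by
  simp only [dens, Set.indicator_univ]
  exact avg_const 1

lemma dens_empty : dens (∅ : Set Ω) = 0 := by
  simp only [dens, Set.indicator_empty]
  exact Finset.expect_const_zero _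

lemma dens_le_one [Nonempty Ω] (A : Set Ω) : dens A ≤ 1 :=
  (dens_mono (Set.subset_univ A)).trans_eq dens_univ

lemma dens_inter_add_diff (A B : Set Ω) : dens (A ∩ B) + dens (A \ B) = dens A := by
  simp only [dens, ← avg_add]
  congr 1
  funext ω
  by_cases h : ω ∈ A <;> by_cases hB : ω ∈ B <;> simp [h, hB]

/-- Fubini for the density of a set of pairs. -/
lemma avg_dens_comm (R : Ω → Set Ω') :
    avg (fun ω => dens (R ω)) = avg (fun ω' => dens {ω | ω' ∈ R ω}) := by
  simp only [dens]
  rw [avg_comm]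
  rfl

/-- If a function with large average is small outside a finite union of sets, then one of these sets
is dense. -/
lemma exists_dens_ge_of_avg_ge [Nonempty Ω] {Λ : Type*} [Finite Λ] {ε : ℝ} (hε : 0 < ε) {f : Ω → ℝ}
    (hf : ∀ ω, f ω ≤ 1) (hfε : ε ≤ avg f) (R : Λ → Set Ω)
    (hR : ∀ ω, ε / 2 ≤ f ω → ∃ l, ω ∈ R l) :
    ∃ l, ε / 2 ≤ Nat.card Λ * dens (R l) := by
  cases nonempty_fintype Λ
  by_contra! h
  have key : avg f ≤ ε / 2 + ∑ l, dens (R l) := by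
    simp only [dens]
    rw [← avg_finset_sum, ← avg_const (Ω := Ω) (ε / 2), ← avg_add]
    refine avg_mono fun ω => ?_
    have hnn : ∀ l ∈ Finset.univ, (0 : ℝ) ≤ (R l).indicator 1 ω :=
      fun l _ => Set.indicator_nonneg (by simp) _
    rcases lt_or_ge (f ω) (ε / 2) with h | h
    · linarith [Finset.sum_nonneg hnn]
    · obtain ⟨l, hl⟩ := hR ω h
      have := Finset.single_le_sum hnn (Finset.mem_univ l)
      simp only [hl, Set.indicator_of_mem, Pi.one_apply] at this
      linarith [hf ω]
  rcases isEmpty_or_nonempty Λ with hΛ | hΛ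
  · simp only [Finset.univ_eq_empty, Finset.sum_empty] at key
    linarith
  · have hc : (0 : ℝ) < Nat.card Λ := Nat.cast_pos.2 Nat.card_pos
    have : ∑ l, dens (R l) < ∑ _l : Λ, ε / 2 / Nat.card Λ := by
      refine Finset.sum_lt_sum_of_nonempty Finset.univ_nonempty fun l _ => ?_
      rw [lt_div_iff₀ hc, mul_comm]
      exact h l
    rw [Finset.sum_const, Finset.card_univ, nsmul_eq_mul, ← Nat.card_eq_fintype_card,
      mul_div_cancel₀ _ hc.ne'] at this
    linarith

end Average

section Cube

open Combinatorics

variable {L η κ κ' ι : Type}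

instance [Finite L] [Finite η] [Finite ι] : Finite (Subspace η L ι) :=
  Finite.of_injective Subspace.idxFun fun _ _ h => Subspace.ext h

instance [Finite L] [Finite ι] : Finite (Line L ι) :=
  Finite.of_injective Line.idxFun fun _ _ h => Line.ext h

lemma avg_sumElim [Finite L] [Finite κ] [Finite κ'] (f : (κ ⊕ κ' → L) → ℝ) :
    avg f = avg (fun t : κ → L => avg (fun z : κ' → L => f (Sum.elim t z))) := by
  rw [← avg_comp_equiv (Equiv.sumArrowEquivProdArrow κ κ' L).symm, avg_prod]
  rfl

namespace Combinatorics.Subspace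

lemma toFun_injective (V : Subspace η L ι) : Function.Injective (V : (η → L) → ι → L) := by
  intro x y h
  funext e
  obtain ⟨i, hi⟩ := V.proper e
  have := congrFun h i
  rwa [apply_inr hi, apply_inr hi] at this

/-- A subspace of the first factor and a point of the second one. -/
def sumConst (V : Subspace η L κ) (z : κ' → L) : Subspace η L (κ ⊕ κ') where
  idxFun := Sum.elim V.idxFun fun i => Sum.inl (z i)
  proper e := let ⟨i, hi⟩ := V.proper e; ⟨Sum.inl i, hi⟩

@[simp] lemma sumConst_apply (V : Subspace η L κ) (z : κ' → L) (t : η → L) :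
    V.sumConst z t = Sum.elim (V t) z := by
  funext i
  cases i <;> rfl

/-- A point of the first factor and a subspace of the second one. -/
def constSum (t : κ → L) (V : Subspace η L κ') : Subspace η L (κ ⊕ κ') where
  idxFun := Sum.elim (fun i => Sum.inl (t i)) V.idxFun
  proper e := let ⟨i, hi⟩ := V.proper e; ⟨Sum.inr i, hi⟩

@[simp] lemma constSum_apply (t : κ → L) (V : Subspace η L κ') (z : η → L) :
    constSum t V z = Sum.elim t (V z) := by
  funext i
  cases i <;> rfl

/-- The product of two subspaces. -/
def prod {η' : Type} (V : Subspace η L κ) (W : Subspace η' L κ') :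
    Subspace (η ⊕ η') L (κ ⊕ κ') where
  idxFun := Sum.elim (fun i => (V.idxFun i).map id Sum.inl) fun i => (W.idxFun i).map id Sum.inr
  proper e := by
    rcases e with e | e
    · obtain ⟨i, hi⟩ := V.proper e
      exact ⟨Sum.inl i, by simp [hi]⟩
    · obtain ⟨i, hi⟩ := W.proper e
      exact ⟨Sum.inr i, by simp [hi]⟩

@[simp] lemma prod_apply {η' : Type} (V : Subspace η L κ) (W : Subspace η' L κ')
    (t : η → L) (z : η' → L) : V.prod W (Sum.elim t z) = Sum.elim (V t) (W z) := by
  funext i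
  rcases i with i | i
  · cases h : V.idxFun i <;> simp [coe_apply, prod, h]
  · cases h : W.idxFun i <;> simp [coe_apply, prod, h]

/-- The image of a line under a subspace embedding. -/
def mapLine (V : Subspace η L ι) (l : Line L η) : Line L ι where
  idxFun i := (V.idxFun i).elim some l.idxFun
  proper := by
    obtain ⟨e, he⟩ := l.proper
    obtain ⟨i, hi⟩ := V.proper e
    exact ⟨i, by simp [hi, he]⟩

@[simp] lemma mapLine_apply (V : Subspace η L ι) (l : Line L η) (a : L) :
    V.mapLine l a = V (l a) := by
  funext i
  cases h : V.idxFun i <;> simp [mapLine, coe_apply, h]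

open Classical in
/-- The subspace obtained from the point `u` by freeing the coordinates in the range of `e`. -/
noncomputable def overwrite (e : κ ↪ ι) (u : ι → L) : Subspace κ L ι where
  idxFun i := if h : ∃ j, e j = i then Sum.inr h.choose else Sum.inl (u i)
  proper j := ⟨e j, by
    have h : ∃ j', e j' = e j := ⟨j, rfl⟩
    simp [e.injective.eq_iff]⟩

@[simp] lemma overwrite_apply_embedding (e : κ ↪ ι) (u : ι → L) (y : κ → L) (j : κ) :
    overwrite e u y (e j) = y j := by
  have h : ∃ j', e j' = e j := ⟨j, rfl⟩
  have : h.choose = j := e.injective h.choose_spec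
  rw [coe_apply, overwrite]
  simp only [dif_pos h, this, Sum.elim_inr]

lemma overwrite_apply_of_forall_ne (e : κ ↪ ι) (u : ι → L) (y : κ → L) {i : ι}
    (hi : ∀ j, e j ≠ i) : overwrite e u y i = u i := by
  have h : ¬ ∃ j', e j' = i := by simpa using hi
  rw [coe_apply, overwrite]
  simp only [dif_neg h, Sum.elim_inl, id]

end Combinatorics.Subspace

open Combinatorics.Subspace

lemma avg_overwrite [Finite L] [Finite κ] [Finite ι] [Nonempty L] (e : κ ↪ ι)
    (f : (ι → L) → ℝ) : avg f = avg (fun u => avg (fun y => f (overwrite e u y))) := by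
  classical
  let s : κ ⊕ {i // i ∉ Set.range e} ≃ ι :=
    (Equiv.sumCongr (Equiv.ofInjective e e.injective) (Equiv.refl _)).trans
      (Equiv.sumCompl (· ∈ Set.range e))
  have hsl : ∀ j, s (Sum.inl j) = e j := fun j => rfl
  have hsr : ∀ r, s (Sum.inr r) = r.1 := fun r => rfl
  let S : (κ ⊕ {i // i ∉ Set.range e} → L) ≃ (ι → L) := Equiv.arrowCongr s (Equiv.refl L)
  have hS : ∀ v i, S v (s i) = v i := fun v i => by simp [S]
  have hov : ∀ t z y, overwrite e (S (Sum.elim t z)) y = S (Sum.elim y z) := by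
    intro t z y
    funext i
    obtain ⟨i, rfl⟩ := s.surjective i
    rw [hS]
    rcases i with j | r
    · rw [hsl]; simp
    · have hr : ∀ j, e j ≠ s (Sum.inr r) := fun j h => r.2 ⟨j, h⟩
      rw [overwrite_apply_of_forall_ne _ _ _ hr, hS]
      rfl
  rw [← avg_comp_equiv S, ← avg_comp_equiv S (fun u => avg (fun y => f (overwrite e u y))),
    avg_sumElim, avg_sumElim]
  simp only [hov]
  rw [avg_const, avg_comm]

/-- A function whose averages over all subspaces of a given dimension are bounded has a bounded
average. -/
lemma avg_le_of_forall_subspace [Finite L] [Nonempty L] [Finite κ] [Finite ι]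
    (h : Nat.card κ ≤ Nat.card ι) {f : (ι → L) → ℝ} {c : ℝ}
    (hf : ∀ V : Subspace κ L ι, avg (fun y => f (V y)) ≤ c) : avg f ≤ c := by
  cases nonempty_fintype κ
  cases nonempty_fintype ι
  rw [Nat.card_eq_fintype_card, Nat.card_eq_fintype_card] at h
  obtain ⟨e⟩ := Function.Embedding.nonempty_of_card_le h
  rw [avg_overwrite e]
  exact avg_le fun u => hf _

lemma exists_subspace_dens_ge [Finite L] [Nonempty L] [Finite κ] [Finite ι]
    (h : Nat.card κ ≤ Nat.card ι) (A : Set (ι → L)) :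
    ∃ V : Subspace κ L ι, dens A ≤ dens {y | V y ∈ A} := by
  cases nonempty_fintype κ
  cases nonempty_fintype ι
  rw [Nat.card_eq_fintype_card, Nat.card_eq_fintype_card] at h
  obtain ⟨e⟩ := Function.Embedding.nonempty_of_card_le h
  obtain ⟨u, hu⟩ := exists_avg_le (fun u => avg (fun y => A.indicator 1 (overwrite e u y)))
  rw [← avg_overwrite e] at hu
  exact ⟨_, hu⟩

end Cube

section Insensitive

open Combinatorics Combinatorics.Subspace

variable {K η κ κ' ι : Type}

/-- A set of words contains no combinatorial line. -/
def LineFree {L : Type} (A : Set (ι → L)) : Prop := ∀ l : Line L ι, ∃ a, l a ∉ A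

/-- The density Hales–Jewett property of a finite alphabet. -/
def DensityHalesJewett (L : Type) [Finite L] : Prop :=
  ∀ δ : ℝ, 0 < δ → ∃ m : ℕ, ∀ (ι : Type) [Finite ι], m ≤ Nat.card ι →
    ∀ A : Set (ι → L), LineFree A → dens A < δ

lemma LineFree.preimage {L : Type} {A : Set (ι → L)} (hA : LineFree A) (V : Subspace η L ι) :
    LineFree {y | V y ∈ A} := fun l => by
  simpa using hA (V.mapLine l)

/-- Replace the extra letter by `a`. -/
def collapse (a : K) (y : ι → Option K) : ι → Option K := fun i => some ((y i).getD a)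

/-- Membership does not change when occurrences of the extra letter are replaced by `a`. -/
def Insensitive (a : K) (D : Set (ι → Option K)) : Prop := ∀ y, collapse a y ∈ D ↔ y ∈ D

lemma collapse_collapse (a : K) (y : ι → Option K) : collapse a (collapse a y) = collapse a y :=
  rfl

lemma collapse_subspace_collapse (a : K) (V : Subspace η (Option K) ι) (y : η → Option K) :
    collapse a (V (collapse a y)) = collapse a (V y) := by
  funext i
  cases h : V.idxFun i <;> simp [collapse, Subspace.coe_apply, h]

lemma collapse_sumElim (a : K) (t : κ → Option K) (z : κ' → Option K) :
    collapse a (Sum.elim t z) = Sum.elim (collapse a t) (collapse a z) := by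
  funext i
  cases i <;> rfl

namespace Insensitive

variable {a : K} {D E : Set (ι → Option K)}

lemma of_collapse (A : Set (ι → Option K)) : Insensitive a {y | collapse a y ∈ A} :=
  fun _ => Iff.rfl

lemma univ : Insensitive a (Set.univ : Set (ι → Option K)) := fun _ => Iff.rfl

lemma compl (hD : Insensitive a D) : Insensitive a Dᶜ := fun y => not_congr (hD y)

lemma diff (hD : Insensitive a D) (hE : Insensitive a E) : Insensitive a (D \ E) :=
  fun y => and_congr (hD y) (not_congr (hE y))

lemma forall_mem {Λ : Type} {D : Λ → Set (ι → Option K)} (hD : ∀ l, Insensitive a (D l)) :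
    Insensitive a {y | ∀ l, y ∈ D l} :=
  fun y => forall_congr' fun l => hD l y

lemma preimage (hD : Insensitive a D) (V : Subspace η (Option K) ι) :
    Insensitive a {y | V y ∈ D} := fun y => by
  simp only [Set.mem_ofPred_eq]
  rw [← hD, collapse_subspace_collapse, hD]

lemma sumElim_left {D : Set (κ ⊕ κ' → Option K)} (hD : Insensitive a D) (t : κ → Option K) :
    Insensitive a {z | Sum.elim t z ∈ D} := fun z => by
  simp only [Set.mem_ofPred_eq]
  rw [← hD, collapse_sumElim, collapse_collapse, ← collapse_sumElim, hD]

lemma sumElim_right {D : Set (κ ⊕ κ' → Option K)} (hD : Insensitive a D) (z : κ' → Option K) :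
    Insensitive a {t | Sum.elim t z ∈ D} := fun t => by
  simp only [Set.mem_ofPred_eq]
  rw [← hD, collapse_sumElim, collapse_collapse, ← collapse_sumElim, hD]

end Insensitive

/-- In a high-dimensional cube over `Option K`, a function is controlled by its averages over the
copies of the cube `η → K` that extend to subspaces. -/
lemma exists_avg_le_of_forall_avg_some [Finite K] [Nonempty K] (n : ℕ) :
    ∃ (η : Type) (_ : Finite η), n ≤ Nat.card η ∧ ∀ ε : ℝ, 0 < ε → ∃ (κ : Type) (_ : Finite κ),
      ∀ F : (κ → Option K) → ℝ, (∀ y, F y ≤ 1) →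
        (∀ V : Subspace η (Option K) κ, avg (fun t : η → K => F (V fun e => some (t e))) ≤ 0) →
        avg F ≤ ε := by
  induction n with
  | zero =>
    refine ⟨Empty, inferInstance, Nat.zero_le _, fun ε hε => ⟨Empty, inferInstance, ?_⟩⟩
    intro F _ h
    have := h ⟨fun e => e.elim, fun e => e.elim⟩
    rw [avg_unique] at this ⊢
    refine (le_of_eq ?_).trans (this.trans hε.le)
    congr 1
    exact Subsingleton.elim _ _
  | succ n ih =>
    obtain ⟨η, _, hη, ih⟩ := ih
    refine ⟨Unit ⊕ η, inferInstance, ?_, fun ε hε => ?_⟩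
    · rw [Nat.card_sum, Nat.card_unique]
      omega
    obtain ⟨κ₀, _, hκ₀⟩ := ih (ε / 2) (half_pos hε)
    set c : ℝ := (Nat.card K : ℝ) with hc
    have hc1 : 1 ≤ c := by
      rw [hc]; exact_mod_cast (Nat.card_pos : 0 < Nat.card K)
    have key : ∀ b : ℕ, ∃ (κ : Type) (_ : Finite κ),
        ∀ F : (κ → Option K) → ℝ, (∀ y, F y ≤ 1) →
          (∀ V : Subspace (Unit ⊕ η) (Option K) κ,
            avg (fun t : Unit ⊕ η → K => F (V fun e => some (t e))) ≤ 0) →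
          avg F ≤ ε / 2 + (1 / (c + 1)) ^ b := by
      intro b
      induction b with
      | zero =>
        refine ⟨Empty, inferInstance, fun F hF _ => ?_⟩
        rw [pow_zero]
        exact (avg_le hF).trans (by linarith)
      | succ b ihb =>
        obtain ⟨κ, _, hκ⟩ := ihb
        refine ⟨Unit ⊕ (κ ⊕ κ₀), inferInstance, fun F hF hV => ?_⟩
        have hnone : avg (fun s => F (Sum.elim (fun _ => none) s)) ≤
            ε / 2 + (1 / (c + 1)) ^ b := by
          rw [avg_sumElim, avg_comm]
          refine avg_le fun z => hκ _ (fun _ => hF _) fun V => ?_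
          simpa using hV (constSum (fun _ => none) (V.sumConst z))
        have hsome : avg (fun a : K => avg (fun s => F (Sum.elim (fun _ => some a) s))) ≤
            ε / 2 := by
          rw [avg_comm, avg_sumElim]
          refine avg_le fun t => hκ₀ _ (fun _ => avg_le fun _ => hF _) fun V => ?_
          have := hV (Subspace.prod (default : Subspace Unit (Option K) Unit) (constSum t V))
          rw [avg_sumElim, ← avg_comp_equiv (Equiv.funUnique Unit K).symm, avg_comm] at this
          convert this using 6 with z a
          rw [show (fun e => some (Sum.elim ((Equiv.funUnique Unit K).symm a) z e)) =
            Sum.elim (fun _ => some a) (fun e => some (z e)) by funext e; cases e <;> rfl]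
          rw [Subspace.prod_apply, constSum_apply]
          rfl
        rw [avg_sumElim, ← avg_comp_equiv (Equiv.funUnique Unit (Option K)).symm, avg_option,
          div_le_iff₀ (by positivity)]
        calc _ ≤ (ε / 2 + (1 / (c + 1)) ^ b) + c * (ε / 2) :=
              add_le_add hnone (mul_le_mul_of_nonneg_left hsome (by positivity))
          _ = _ := by
              rw [pow_succ]
              field_simp
              ring
    obtain ⟨b, hb⟩ := exists_pow_lt_of_lt_one (half_pos hε)
      (show 1 / (c + 1) < 1 by rw [div_lt_one (by positivity)]; linarith)
    obtain ⟨κ, _, hκ⟩ := key b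
    exact ⟨κ, inferInstance, fun F hF hV => (hκ F hF hV).trans (by linarith)⟩

end Insensitive

section Covering

open Combinatorics Combinatorics.Subspace

variable {K : Type} [Finite K] [Nonempty K]

lemma exists_line_subset_of_insensitive (hK : DensityHalesJewett K) {ε : ℝ} (hε : 0 < ε) :
    ∃ (κ : Type) (_ : Finite κ), ∀ (a : K) (D : Set (κ → Option K)), Insensitive a D →
      ε ≤ dens D → ∃ l : Line (Option K) κ, ∀ b, l b ∈ D := by
  obtain ⟨m, hm⟩ := hK (ε / 2) (half_pos hε)
  obtain ⟨η, _, hη, hη'⟩ := exists_avg_le_of_forall_avg_some (K := K) m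
  obtain ⟨κ, _, hκ⟩ := hη' (ε / 4) (by positivity)
  refine ⟨κ, inferInstance, fun a D hD hDε => ?_⟩
  by_contra! hl
  have key : avg (fun y => D.indicator 1 y - ε / 2) ≤ ε / 4 := by
    refine hκ _ (fun y => ?_) fun V => ?_
    · have : D.indicator (1 : (κ → Option K) → ℝ) y ≤ 1 := Set.indicator_le_self' (by simp) y
      linarith
    · rw [avg_sub, avg_const]
      have : dens {t : η → K | V (fun e => some (t e)) ∈ D} < ε / 2 := by
        refine hm η hη _ fun l => ?_
        by_contra! h
        obtain ⟨b, hb⟩ := hl (V.mapLine (l.map some))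
        refine hb ?_
        rw [mapLine_apply]
        refine (hD.preimage V _).1 ?_
        have : collapse a (l.map some b) = fun e => some (l (b.getD a) e) := by
          funext e
          cases hle : l.idxFun e <;> simp [collapse, Line.map, hle]
        rw [this]
        exact h (b.getD a)
      have h2 : dens {t : η → K | V (fun e => some (t e)) ∈ D} =
        avg (fun t : η → K => D.indicator 1 (V fun e => some (t e))) := rfl
      linarith
  rw [avg_sub, avg_const] at key
  have h2 : dens D = avg (D.indicator 1) := rfl
  linarith

lemma exists_subspace_subset_of_insensitive (hK : DensityHalesJewett K) (n : ℕ) :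
    ∃ (η : Type) (_ : Finite η), n ≤ Nat.card η ∧ ∀ ε : ℝ, 0 < ε → ∃ (κ : Type) (_ : Finite κ),
      ∀ (a : K) (D : Set (κ → Option K)), Insensitive a D → ε ≤ dens D →
        ∃ V : Subspace η (Option K) κ, ∀ t, V t ∈ D := by
  induction n with
  | zero =>
    refine ⟨Empty, inferInstance, Nat.zero_le _, fun ε hε => ⟨Empty, inferInstance, ?_⟩⟩
    intro a D _ hD
    refine ⟨default, fun t => ?_⟩
    by_contra h
    have : D = ∅ := Set.eq_empty_of_forall_notMem fun y hy => h (by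
      rwa [Subsingleton.elim (Subspace.toFun default t) y])
    rw [this, dens_empty] at hD
    linarith
  | succ n ih =>
    obtain ⟨η, _, hη, ih⟩ := ih
    refine ⟨Unit ⊕ η, inferInstance, ?_, fun ε hε => ?_⟩
    · rw [Nat.card_sum, Nat.card_unique]
      omega
    obtain ⟨κ₁, _, hκ₁⟩ := exists_line_subset_of_insensitive hK (half_pos hε)
    set N : ℝ := (Nat.card (Line (Option K) κ₁) : ℝ) with hN
    have hN0 : 0 ≤ N := Nat.cast_nonneg _
    obtain ⟨κ, _, hκ⟩ := ih (ε / 2 / (N + 1)) (by positivity)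
    refine ⟨κ₁ ⊕ κ, inferInstance, fun a D hD hDε => ?_⟩
    have havg : ε ≤ avg (fun z : κ → Option K => dens {t | Sum.elim t z ∈ D}) := by
      refine hDε.trans_eq ?_
      rw [dens, avg_sumElim, avg_comm]
      rfl
    obtain ⟨l, hl⟩ := exists_dens_ge_of_avg_ge (Λ := Line (Option K) κ₁) hε
      (fun z => dens_le_one _) havg (fun l => {z | ∀ b, Sum.elim (l b) z ∈ D})
      fun z hz => hκ₁ a _ (hD.sumElim_right z) hz
    obtain ⟨V, hV⟩ := hκ a _ (Insensitive.forall_mem fun b => hD.sumElim_left (l b)) (by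
      rw [div_le_iff₀ (by positivity), mul_comm]
      exact hl.trans (mul_le_mul_of_nonneg_right (by linarith) (dens_nonneg _)))
    refine ⟨Subspace.prod l.toSubspaceUnit V, fun t => ?_⟩
    rw [← Sum.elim_comp_inl_inr t, Subspace.prod_apply, Line.toSubspaceUnit_apply]
    exact hV _ _

/-- A function with nonpositive averages on subspaces has an almost nonpositive average on every
insensitive set, because such a set can almost be partitioned into subspaces. -/
lemma exists_avg_indicator_le_of_insensitive (hK : DensityHalesJewett K) (n : ℕ) :
    ∃ (η : Type) (_ : Finite η), n ≤ Nat.card η ∧ ∀ ε : ℝ, 0 < ε → ∃ (κ : Type) (_ : Finite κ),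
      ∀ F : (κ → Option K) → ℝ, (∀ y, F y ≤ 1) →
        (∀ V : Subspace η (Option K) κ, avg (fun t => F (V t)) ≤ 0) →
        ∀ (a : K) (D : Set (κ → Option K)), Insensitive a D → avg (D.indicator F) ≤ ε := by
  obtain ⟨η, _, hη, hsub⟩ := exists_subspace_subset_of_insensitive hK n
  refine ⟨η, inferInstance, hη, fun ε hε => ?_⟩
  obtain ⟨κ₁, _, hκ₁⟩ := hsub (ε / 2 / 2) (by positivity)
  set N : ℝ := (Nat.card (Subspace η (Option K) κ₁) : ℝ) with hN
  have hN0 : 0 ≤ N := Nat.cast_nonneg _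
  set q : ℝ := (Nat.card (η → Option K) : ℝ) / Nat.card (κ₁ → Option K) with hq
  have hq0 : 0 < q := div_pos (Nat.cast_pos.2 Nat.card_pos) (Nat.cast_pos.2 Nat.card_pos)
  obtain ⟨c, hc0, hc1, hcq⟩ : ∃ c : ℝ, 0 < c ∧ c ≤ 1 ∧ c ≤ q * (ε / 2 / 2 / (N + 1)) :=
    ⟨min 1 (q * (ε / 2 / 2 / (N + 1))), by positivity, min_le_left _ _, min_le_right _ _⟩
  have key : ∀ r : ℕ, ∃ (κ : Type) (_ : Finite κ),
      ∀ F : (κ → Option K) → ℝ, (∀ y, F y ≤ 1) →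
        (∀ V : Subspace η (Option K) κ, avg (fun t => F (V t)) ≤ 0) →
        ∀ (a : K) (D : Set (κ → Option K)), Insensitive a D →
          avg (D.indicator F) ≤ ε / 2 + (1 - c) ^ r * dens D := by
    intro r
    have hmono : ∀ {κ : Type} [Finite κ] (F : (κ → Option K) → ℝ), (∀ y, F y ≤ 1) →
        ∀ D : Set (κ → Option K), avg (D.indicator F) ≤ dens D := fun F hF D =>
      avg_mono fun y => Set.indicator_le_indicator (hF y)
    induction r with
    | zero =>
      refine ⟨Empty, inferInstance, fun F hF _ a D _ => ?_⟩
      linarith [hmono F hF D]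
    | succ r ih =>
      obtain ⟨κ, _, hκ⟩ := ih
      refine ⟨κ₁ ⊕ κ, inferInstance, fun F hF hFV a D hD => ?_⟩
      have hpow : 0 ≤ (1 - c) ^ r := pow_nonneg (by linarith) r
      rcases le_or_gt (dens D) (ε / 2) with hDε | hDε
      · have : 0 ≤ (1 - c) ^ (r + 1) * dens D :=
          mul_nonneg (pow_nonneg (by linarith) _) (dens_nonneg _)
        linarith [hmono F hF D]
      have havg : ε / 2 ≤ avg (fun z : κ → Option K => dens {t | Sum.elim t z ∈ D}) := by
        refine hDε.le.trans_eq ?_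
        rw [dens, avg_sumElim, avg_comm]
        rfl
      obtain ⟨V, hV⟩ := exists_dens_ge_of_avg_ge (Λ := Subspace η (Option K) κ₁) (half_pos hε)
        (fun z => dens_le_one _) havg (fun V => {z | ∀ t, Sum.elim (V t) z ∈ D})
        fun z hz => hκ₁ a _ (hD.sumElim_right z) hz
      set Z : Set (κ → Option K) := {z | ∀ t, Sum.elim (V t) z ∈ D} with hZ
      have hZins : Insensitive a Z := Insensitive.forall_mem fun t => hD.sumElim_left (V t)
      have hZdens : ε / 2 / 2 / (N + 1) ≤ dens Z := by
        rw [div_le_iff₀ (by positivity), mul_comm]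
        exact hV.trans (mul_le_mul_of_nonneg_right (by linarith) (dens_nonneg _))
      -- the covered part of `D`
      set P : Set (κ₁ ⊕ κ → Option K) :=
        {y | (y ∘ Sum.inl) ∈ Set.range V ∧ (y ∘ Sum.inr) ∈ Z} with hP
      have hPD : P ⊆ D := by
        rintro y ⟨⟨t, ht⟩, hz⟩
        rw [← Sum.elim_comp_inl_inr y, ← ht]
        exact hz t
      have hPavg : ∀ G : (κ₁ ⊕ κ → Option K) → ℝ, avg (P.indicator G) =
          avg (Z.indicator fun z => q * avg (fun t => G (Sum.elim (V t) z))) := by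
        intro G
        rw [avg_sumElim, avg_comm]
        congr 1
        funext z
        by_cases hz : z ∈ Z
        · rw [Set.indicator_of_mem hz, hq,
            ← avg_indicator_range V.toFun_injective fun t => G (Sum.elim t z)]
          congr 1
          funext t
          by_cases ht : t ∈ Set.range V
          · rw [Set.indicator_of_mem ht, Set.indicator_of_mem]
            exact ⟨ht, hz⟩
          · rw [Set.indicator_of_notMem ht, Set.indicator_of_notMem]
            exact fun h => ht h.1
        · rw [Set.indicator_of_notMem hz]
          refine (congrArg avg (funext fun t => ?_)).trans (avg_const 0)
          exact Set.indicator_of_notMem (fun h => hz h.2) _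
      have hPF : avg (P.indicator F) ≤ 0 := by
        rw [hPavg]
        refine avg_le fun z => Set.indicator_le' (fun z _ => ?_) (fun _ _ => le_rfl) z
        refine mul_nonpos_of_nonneg_of_nonpos hq0.le ?_
        simpa using hFV (V.sumConst z)
      have hPdens : c ≤ dens P := by
        rw [dens, hPavg]
        have : Z.indicator (fun z => q * avg (fun t : η → Option K =>
            (1 : (κ₁ ⊕ κ → Option K) → ℝ) (Sum.elim (V t) z))) =
            fun z => q * Z.indicator 1 z := by
          funext z
          by_cases hz : z ∈ Z
          · simp only [Set.indicator_of_mem hz, Pi.one_apply, avg_const]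
          · simp only [Set.indicator_of_notMem hz, mul_zero]
        rw [this, avg_const_mul]
        exact hcq.trans (mul_le_mul_of_nonneg_left hZdens hq0.le)
      have hsplit : avg (D.indicator F) = avg (P.indicator F) + avg ((D \ P).indicator F) := by
        rw [← avg_add]
        congr 1
        funext y
        by_cases h : y ∈ P
        · simp [h, hPD h]
        · by_cases h' : y ∈ D <;> simp [h, h']
      have hrest : avg ((D \ P).indicator F) ≤ ε / 2 + (1 - c) ^ r * dens (D \ P) := by
        rw [dens, avg_sumElim, avg_sumElim, ← avg_const_mul,
          ← avg_const (Ω := κ₁ → Option K) (ε / 2), ← avg_add]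
        refine avg_mono fun t => ?_
        refine hκ (fun z => F (Sum.elim t z)) (fun _ => hF _) (fun W => ?_) a
          {z | Sum.elim t z ∈ D \ P} ?_
        · simpa using hFV (constSum t W)
        · refine (hD.sumElim_left t).diff (E := {z | Sum.elim t z ∈ P}) ?_
          intro z
          exact and_congr Iff.rfl (hZins z)
      have hdens := dens_inter_add_diff D P
      rw [Set.inter_eq_right.2 hPD] at hdens
      have h1 : dens (D \ P) ≤ (1 - c) * dens D := by
        nlinarith [dens_le_one D]
      calc avg (D.indicator F) ≤ ε / 2 + (1 - c) ^ r * dens (D \ P) := by linarith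
        _ ≤ ε / 2 + (1 - c) ^ r * ((1 - c) * dens D) := by gcongr
        _ = _ := by ring
  obtain ⟨r, hr⟩ := exists_pow_lt_of_lt_one (half_pos hε) (show 1 - c < 1 by linarith)
  obtain ⟨κ, _, hκ⟩ := key r
  refine ⟨κ, inferInstance, fun F hF hFV a D hD => (hκ F hF hFV a D hD).trans ?_⟩
  have : (1 - c) ^ r * dens D ≤ (1 - c) ^ r :=
    mul_le_of_le_one_right (pow_nonneg (by linarith) r) (dens_le_one D)
  linarith

end Covering

section Increment

open Combinatorics Combinatorics.Subspace

/-- All line-free sets in high-dimensional cubes over `L` have density less than `δ`. -/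
def LineFreeDensLT (L : Type) [Finite L] (δ : ℝ) : Prop :=
  ∃ m : ℕ, ∀ (ι : Type) [Finite ι], m ≤ Nat.card ι →
    ∀ A : Set (ι → L), LineFree A → dens A < δ

variable {K : Type} [Finite K]

/-- The density of a line-free set on an intersection of insensitive sets does not exceed the
maximal density of line-free sets. -/
lemma exists_dens_inter_le [Nonempty K] (hK : DensityHalesJewett K) {δ₀ : ℝ} (hδ₀ : 0 ≤ δ₀)
    (hU : ∀ ε : ℝ, 0 < ε → LineFreeDensLT (Option K) (δ₀ + ε)) (s : Finset K) :
    ∀ ε : ℝ, 0 < ε → ∃ m : ℕ, ∀ (ι : Type) [Finite ι], m ≤ Nat.card ι →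
      ∀ A : Set (ι → Option K), LineFree A → ∀ D : K → Set (ι → Option K),
        (∀ a, Insensitive a (D a)) →
        dens (A ∩ ⋂ a ∈ s, D a) ≤ (δ₀ + ε) * dens (⋂ a ∈ s, D a) + ε := by
  classical
  induction s using Finset.induction_on with
  | empty =>
    intro ε hε
    obtain ⟨m, hm⟩ := hU ε hε
    refine ⟨m, fun ι _ hι A hA D _ => ?_⟩
    have := hm ι hι A hA
    simp only [Finset.notMem_empty, Set.iInter_of_empty, Set.iInter_univ, Set.inter_univ,
      dens_univ]
    linarith
  | insert a s _ ih =>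
    intro ε hε
    obtain ⟨m, hm⟩ := ih (ε / 2) (half_pos hε)
    obtain ⟨η, _, hη, hcov⟩ := exists_avg_indicator_le_of_insensitive hK m
    obtain ⟨κ, _, hκ⟩ := hcov (ε / 2) (half_pos hε)
    refine ⟨Nat.card κ, fun ι _ hι A hA D hD => ?_⟩
    set S : Set (ι → Option K) := ⋂ b ∈ s, D b with hS
    let F : (ι → Option K) → ℝ := fun y =>
      (A ∩ S).indicator 1 y - (δ₀ + ε / 2) * S.indicator 1 y - ε / 2
    have hF1 : ∀ y, F y ≤ 1 := fun y => by
      have h1 : (A ∩ S).indicator (1 : (ι → Option K) → ℝ) y ≤ 1 :=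
        Set.indicator_le_self' (by simp) y
      have h2 : 0 ≤ S.indicator (1 : (ι → Option K) → ℝ) y := Set.indicator_nonneg (by simp) y
      have : 0 ≤ (δ₀ + ε / 2) * S.indicator (1 : (ι → Option K) → ℝ) y := by positivity
      simp only [F]
      linarith
    have hmain : avg ((D a).indicator F) ≤ ε / 2 := by
      refine avg_le_of_forall_subspace hι fun V => ?_
      refine hκ (fun y => F (V y)) (fun _ => hF1 _) (fun W => ?_) a {y | V y ∈ D a}
        ((hD a).preimage V)
      have := hm η hη _ ((hA.preimage V).preimage W) _ fun b => ((hD b).preimage V).preimage W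
      have hset : (⋂ b ∈ s, {y | W y ∈ {y | V y ∈ D b}}) = {y | V (W y) ∈ S} := by
        ext y
        simp [hS]
      rw [hset] at this
      simp only [F]
      rw [avg_sub, avg_sub, avg_const_mul, avg_const]
      have h1 : avg (fun t => (A ∩ S).indicator 1 (V (W t))) =
        dens ({y | W y ∈ {y | V y ∈ A}} ∩ {y | V (W y) ∈ S}) := rfl
      have h2 : avg (fun t => S.indicator 1 (V (W t))) = dens {y | V (W y) ∈ S} := rfl
      rw [h1, h2]
      linarith
    have hsplit : avg ((D a).indicator F) = dens (A ∩ (D a ∩ S)) -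
        (δ₀ + ε / 2) * dens (D a ∩ S) - ε / 2 * dens (D a) := by
      simp only [dens]
      rw [← avg_const_mul, ← avg_const_mul, ← avg_sub, ← avg_sub]
      congr 1
      funext y
      by_cases h1 : y ∈ D a <;> by_cases h2 : y ∈ A <;> by_cases h3 : y ∈ S <;>
        simp [F, h1, h2, h3]
    rw [Finset.set_biInter_insert, ← hS]
    have h1 := dens_le_one (D a)
    have h2 := dens_nonneg (D a ∩ S)
    nlinarith

/-- A variant of `exists_dens_inter_le` for the complement of an intersection of insensitive
sets. -/
lemma exists_dens_diff_le [Nonempty K] (hK : DensityHalesJewett K) {δ₀ : ℝ} (hδ₀ : 0 ≤ δ₀)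
    (hU : ∀ ε : ℝ, 0 < ε → LineFreeDensLT (Option K) (δ₀ + ε)) {ε : ℝ} (hε : 0 < ε) :
    ∃ m : ℕ, ∀ (ι : Type) [Finite ι], m ≤ Nat.card ι →
      ∀ A : Set (ι → Option K), LineFree A → ∀ D : K → Set (ι → Option K),
        (∀ a, Insensitive a (D a)) →
        dens (A \ ⋂ a, D a) ≤ (δ₀ + ε) * (1 - dens (⋂ a, D a)) + Nat.card K * ε := by
  classical
  cases nonempty_fintype K
  obtain ⟨m, hm⟩ := exists_dens_inter_le hK hδ₀ hU Finset.univ ε hε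
  refine ⟨m, fun ι _ hι A hA D hD => ?_⟩
  have key : ∀ s : Finset K, dens (A \ ⋂ a ∈ s, D a) ≤
      (δ₀ + ε) * (1 - dens (⋂ a ∈ s, D a)) + s.card * ε := by
    intro s
    induction s using Finset.induction_on with
    | empty => simp [dens_empty, dens_univ]
    | insert a s has ih =>
      set S : Set (ι → Option K) := ⋂ b ∈ s, D b with hS
      have h := hm ι hι A hA (fun b => if b ∈ s then D b else if b = a then (D a)ᶜ else Set.univ)
        fun b => by
          split_ifs with h1 h2
          · exact hD b
          · exact h2 ▸ (hD b).compl
          · exact Insensitive.univ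
      have hset : (⋂ b ∈ Finset.univ,
          (if b ∈ s then D b else if b = a then (D a)ᶜ else Set.univ)) = S \ D a := by
        ext y
        simp only [Finset.mem_univ, Set.iInter_true, Set.mem_iInter, hS, Set.mem_sdiff]
        constructor
        · refine fun h => ⟨fun b hb => by simpa [hb] using h b, ?_⟩
          simpa [has] using h a
        · rintro ⟨h1, h2⟩ b
          split_ifs with h3 h4
          · exact h1 b h3
          · exact h2
          · trivial
      rw [hset] at h
      have h1 := dens_inter_add_diff S (D a)
      have h2 := dens_inter_add_diff (A \ (D a ∩ S)) S
      have h3 : (A \ (D a ∩ S)) ∩ S = A ∩ (S \ D a) := by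
        ext y; simp only [Set.mem_inter_iff, Set.mem_sdiff]; tauto
      have h4 : (A \ (D a ∩ S)) \ S = A \ S := by
        ext y; simp only [Set.mem_inter_iff, Set.mem_sdiff]; tauto
      rw [h3, h4] at h2
      rw [Finset.set_biInter_insert, ← hS, Finset.card_insert_of_notMem has, Set.inter_comm (D a) S]
      rw [Set.inter_comm (D a) S] at h2
      push_cast
      rw [← h2]
      have : dens (S \ D a) = dens S - dens (S ∩ D a) := by linarith
      rw [this] at h
      linarith
  have := key Finset.univ
  simpa [Nat.card_eq_fintype_card] using this

end Increment

section Induction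

open Combinatorics Combinatorics.Subspace

variable {K : Type}

lemma LineFree.sumElim_right {L κ κ' : Type} {A : Set (κ ⊕ κ' → L)} (hA : LineFree A)
    (z : κ' → L) : LineFree {t : κ → L | Sum.elim t z ∈ A} := by
  have := hA.preimage (sumConst (default : Subspace κ L κ) z)
  convert this using 3
  rw [sumConst_apply]
  rfl

lemma LineFree.sumElim_left {L κ κ' : Type} {A : Set (κ ⊕ κ' → L)} (hA : LineFree A)
    (t : κ → L) : LineFree {z : κ' → L | Sum.elim t z ∈ A} := by
  have := hA.preimage (constSum t (default : Subspace κ' L κ'))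
  convert this using 3
  rw [constSum_apply]
  rfl

/-- If `δ₀` is the maximal density of line-free sets, there are random line-free sets containing
every given point with probability almost `δ₀`. -/
lemma exists_lineFree_family {L : Type} [Finite L] [Nonempty L] {δ₀ : ℝ}
    (hU : ∀ ε : ℝ, 0 < ε → LineFreeDensLT L (δ₀ + ε))
    (hLo : ∀ ε : ℝ, 0 < ε → ¬ LineFreeDensLT L (δ₀ - ε))
    (κ : Type) [Finite κ] {η : ℝ} (hη : 0 < η) :
    ∃ (Ω : Type) (_ : Finite Ω) (_ : Nonempty Ω) (A : Ω → Set (κ → L)),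
      (∀ ω, LineFree (A ω)) ∧ ∀ t, δ₀ - η ≤ dens {ω | t ∈ A ω} := by
  cases nonempty_fintype (κ → L)
  set N : ℝ := (Nat.card (κ → L) : ℝ) with hN
  have hN0 : 0 < N := Nat.cast_pos.2 Nat.card_pos
  set ε := η / (2 * N) with hε
  have hε0 : 0 < ε := by positivity
  obtain ⟨n, hn⟩ := hU ε hε0
  have hlo := hLo ε hε0
  simp only [LineFreeDensLT, not_exists, not_forall, not_lt] at hlo
  obtain ⟨ι, _, hι, A, hA, hdA⟩ := hlo (Nat.card (κ ⊕ Fin n))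
  obtain ⟨V, hV⟩ := exists_subspace_dens_ge hι A
  have hB := hA.preimage V
  set B := {y | V y ∈ A}
  refine ⟨Fin n → L, inferInstance, inferInstance, fun ω => {t | Sum.elim t ω ∈ B},
    fun ω => hB.sumElim_right ω, fun t => ?_⟩
  have hlt : ∀ t : κ → L, dens {z : Fin n → L | Sum.elim t z ∈ B} < δ₀ + ε :=
    fun t => hn (Fin n) (by simp) _ (hB.sumElim_left t)
  have havg : avg (fun t : κ → L => dens {z : Fin n → L | Sum.elim t z ∈ B}) = dens B := by
    simp only [dens]
    rw [avg_sumElim]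
    rfl
  have h2 : avg (fun t : κ → L => δ₀ + ε - dens {z : Fin n → L | Sum.elim t z ∈ B}) ≤ 2 * ε := by
    rw [avg_sub, avg_const, havg]
    linarith
  rw [avg_eq_sum_div, div_le_iff₀ hN0] at h2
  have h3 := Finset.single_le_sum (f := fun t : κ → L =>
    δ₀ + ε - dens {z : Fin n → L | Sum.elim t z ∈ B}) (fun t _ => by linarith [hlt t])
    (Finset.mem_univ t)
  have h4 : 2 * ε * N = η := by rw [hε]; field_simp
  simp only [Set.mem_ofPred_eq]
  linarith

/-- A line-free set containing a point and all its collapses. -/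
lemma LineFree.ne_none {ι : Type} {A : Set (ι → Option K)} (hA : LineFree A) {x : ι → Option K}
    (hx : x ∈ A) (hc : ∀ a, collapse a x ∈ A) (i : ι) : x i ≠ none := by
  intro hi
  let l : Line (Option K) ι := ⟨fun i => (x i).map some, i, by simp [hi]⟩
  obtain ⟨b, hb⟩ := hA l
  refine hb ?_
  cases b with
  | none =>
    convert hx using 1
    funext j
    cases h : x j <;> simp [l, Line.coe_apply, h]
  | some a =>
    convert hc a using 1
    funext j
    cases h : x j <;> simp [l, Line.coe_apply, collapse, h]

lemma dens_range_some [Finite K] (μ : Type) [Finite μ] [Nonempty K] :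
    dens (Set.range fun (t : μ → K) j => some (t j)) =
      ((Nat.card K : ℝ) / (Nat.card K + 1)) ^ Nat.card μ := by
  have hinj : Function.Injective fun (t : μ → K) (j : μ) => some (t j) := fun s t h =>
    funext fun j => Option.some_injective _ (congrFun h j)
  rw [dens, avg_indicator_range hinj]
  rw [show avg (fun t : μ → K => (1 : (μ → Option K) → ℝ) fun j => some (t j)) = 1 from
    avg_const 1, mul_one, div_pow]
  simp [Nat.card_fun, Finite.card_option]

/-- Fill the occurrences of the extra letter in `u` by the template of a line. -/
def fillLine {β μ : Type} (w : Line K β) (u : β × μ → Option K) : β × μ → Option K :=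
  fun p => (u p).or (w.idxFun p.1)

lemma collapse_fillLine {β μ : Type} (w : Line K β) (u : β × μ → Option K) (a : K) :
    collapse a (fillLine w u) = fun p => some ((u p).getD (w a p.1)) := by
  funext p
  cases h : u p <;> simp [collapse, fillLine, h, Line.coe_apply]

lemma fillLine_overwrite {β μ : Type} (w : Line K β) {i₀ : β} (hi₀ : w.idxFun i₀ = none)
    (u : β × μ → Option K) (y : μ → Option K) :
    fillLine w (overwrite ⟨Prod.mk i₀, Prod.mk_right_injective i₀⟩ u y) =
      overwrite ⟨Prod.mk i₀, Prod.mk_right_injective i₀⟩ (fillLine w u) y := by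
  funext p
  by_cases h : ∃ j, (⟨Prod.mk i₀, Prod.mk_right_injective i₀⟩ : μ ↪ β × μ) j = p
  · obtain ⟨j, rfl⟩ := h
    simp only [fillLine]
    rw [overwrite_apply_embedding, overwrite_apply_embedding]
    simp [hi₀]
  · have h' : ∀ j, (⟨Prod.mk i₀, Prod.mk_right_injective i₀⟩ : μ ↪ β × μ) j ≠ p := by
      simpa using h
    simp only [fillLine]
    rw [overwrite_apply_of_forall_ne _ _ _ h', overwrite_apply_of_forall_ne _ _ _ h']
    rfl

/-- A random line-free set contains, with positive probability, all collapses of a random point of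
the form `fillLine w u`. -/
lemma exists_fillLine_dens_ge [Finite K] [Nonempty K]
    {β μ Ω : Type} [Finite β] [Finite μ] [Finite Ω]
    [Nonempty Ω] {δ : ℝ} (hδ : 0 < δ)
    (hβ : ∀ B : Set (β → K), LineFree B → dens B < δ / 2)
    (A : Ω → Set (β × μ → Option K)) (hA : ∀ t, δ ≤ dens {ω | t ∈ A ω}) :
    ∃ w : Line K β, δ / 2 ≤ Nat.card (Line K β) *
      dens {v : Ω × (β × μ → Option K) | ∀ a, collapse a (fillLine w v.2) ∈ A v.1} := by
  refine exists_dens_ge_of_avg_ge hδ (f := fun v : Ω × (β × μ → Option K) =>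
    dens {t : β → K | (fun p => some ((v.2 p).getD (t p.1))) ∈ A v.1})
    (fun _ => dens_le_one _) ?_ _ ?_
  · rw [avg_prod, avg_comm]
    refine le_avg fun u => ?_
    rw [avg_dens_comm]
    exact le_avg fun t => hA fun p => some ((u p).getD (t p.1))
  · intro v hv
    have : ¬ LineFree {t : β → K | (fun p => some ((v.2 p).getD (t p.1))) ∈ A v.1} :=
      fun h => absurd (hβ _ h) (not_lt.2 hv)
    simp only [LineFree, not_forall, not_exists, not_not] at this
    obtain ⟨w, hw⟩ := this
    exact ⟨w, fun a => by rw [collapse_fillLine]; exact hw a⟩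

/-- A line-free set of almost maximal density cannot meet the collapses of its points too often. -/
lemma false_of_lineFree_maximal [Finite K] [Nonempty K] (hK : DensityHalesJewett K)
    {δ₀ : ℝ} (hδ₀ : 0 < δ₀)
    (hU : ∀ ε : ℝ, 0 < ε → LineFreeDensLT (Option K) (δ₀ + ε))
    (hLo : ∀ ε : ℝ, 0 < ε → ¬ LineFreeDensLT (Option K) (δ₀ - ε)) : False := by
  obtain ⟨m₀, hm₀⟩ := hK (δ₀ / 2 / 2) (by positivity)
  set c : ℝ := (Nat.card K : ℝ) with hc
  have hc0 : 0 ≤ c := Nat.cast_nonneg _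
  set θ : ℝ := δ₀ / 2 / 2 / (Nat.card (Line K (Fin m₀)) + 1) with hθ
  have hθ0 : 0 < θ := by positivity
  set ε := δ₀ * θ / (8 * (c + 1)) with hε
  have hε0 : 0 < ε := by positivity
  set η := min (δ₀ * θ ^ 2 / 32) (δ₀ / 2) with hη
  have hη0 : 0 < η := by positivity
  obtain ⟨m₁, hm₁⟩ := exists_dens_diff_le hK hδ₀.le hU hε0
  obtain ⟨m₂, hm₂⟩ := hU η hη0
  obtain ⟨m₃, hm₃⟩ := exists_pow_lt_of_lt_one (show 0 < δ₀ * θ / 8 by positivity)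
    (show c / (c + 1) < 1 by rw [div_lt_one (by positivity)]; linarith)
  set M := max m₁ (max m₂ m₃) with hM
  obtain ⟨Ω, _, _, A, hA, hdA⟩ := exists_lineFree_family hU hLo (Fin m₀ × Fin M) hη0
  obtain ⟨w, hw⟩ := exists_fillLine_dens_ge (δ := δ₀ / 2) (by positivity)
    (hm₀ (Fin m₀) (by simp)) A
    (fun t => le_trans (by linarith [min_le_right (δ₀ * θ ^ 2 / 32) (δ₀ / 2)]) (hdA t))
  obtain ⟨i₀, hi₀⟩ := w.proper
  let e : Fin M ↪ Fin m₀ × Fin M := ⟨Prod.mk i₀, Prod.mk_right_injective i₀⟩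
  let V : (Fin m₀ × Fin M → Option K) → Subspace (Fin M) (Option K) (Fin m₀ × Fin M) :=
    fun u => overwrite e (fillLine w u)
  let D : Ω × (Fin m₀ × Fin M → Option K) → K → Set (Fin M → Option K) :=
    fun v a => {y | V v.2 y ∈ {x | collapse a x ∈ A v.1}}
  let A' : Ω × (Fin m₀ × Fin M → Option K) → Set (Fin M → Option K) :=
    fun v => {y | V v.2 y ∈ A v.1}
  have hA' : ∀ v, LineFree (A' v) := fun v => (hA v.1).preimage _
  have hD : ∀ v a, Insensitive a (D v a) := fun v a => (Insensitive.of_collapse _).preimage _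
  have hlt : ∀ v, dens (A' v) < δ₀ + η := fun v =>
    hm₂ (Fin M) (by simp [hM]) _ (hA' v)
  have havgA : δ₀ - η ≤ avg (fun v => dens (A' v)) := by
    rw [avg_prod, avg_comm]
    refine le_avg fun u => ?_
    rw [avg_dens_comm]
    exact le_avg fun y => hdA (V u y)
  have havgD : θ ≤ avg (fun v => dens (⋂ a, D v a)) := by
    have h1 : dens {v : Ω × (Fin m₀ × Fin M → Option K) |
        ∀ a, collapse a (fillLine w v.2) ∈ A v.1} = avg (fun v => dens (⋂ a, D v a)) := by
      rw [dens, avg_prod, avg_prod]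
      congr 1
      funext ω
      rw [avg_overwrite e]
      congr 1
      funext u
      rw [dens]
      congr 1
      funext y
      classical
      rw [Set.indicator_apply, Set.indicator_apply]
      congr 1
      simp only [Set.mem_ofPred_eq, Set.mem_iInter, D, V, e, fillLine_overwrite w hi₀]
    rw [← h1, hθ, div_le_iff₀ (by positivity)]
    refine hw.trans ?_
    have := dens_nonneg {v : Ω × (Fin m₀ × Fin M → Option K) |
        ∀ a, collapse a (fillLine w v.2) ∈ A v.1}
    nlinarith
  obtain ⟨v, hv⟩ := exists_avg_le (fun v => dens (⋂ a, D v a) -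
    θ / (4 * η) * (δ₀ + η - dens (A' v)))
  rw [avg_sub, avg_const_mul, avg_sub, avg_const] at hv
  have h1 : θ / (4 * η) * (δ₀ + η - avg (fun v => dens (A' v))) ≤ θ / (4 * η) * (2 * η) :=
    mul_le_mul_of_nonneg_left (by linarith) (by positivity)
  have h2 : θ / (4 * η) * (2 * η) = θ / 2 := by field_simp; norm_num
  have h3 : θ / 2 ≤ dens (⋂ a, D v a) - θ / (4 * η) * (δ₀ + η - dens (A' v)) := by linarith
  have h4 : 0 ≤ θ / (4 * η) * (δ₀ + η - dens (A' v)) :=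
    mul_nonneg (by positivity) (by linarith [hlt v])
  have h5 : θ / (4 * η) * (δ₀ + η - dens (A' v)) ≤ 1 := by
    linarith [dens_le_one (⋂ a, D v a)]
  have h6 : δ₀ + η - dens (A' v) ≤ δ₀ * θ / 8 := by
    have h7 : δ₀ + η - dens (A' v) ≤ 4 * η / θ := by
      rw [le_div_iff₀ hθ0]
      rw [div_mul_eq_mul_div, div_le_one (by positivity)] at h5
      linarith
    refine h7.trans ?_
    rw [div_le_iff₀ hθ0]
    nlinarith [min_le_left (δ₀ * θ ^ 2 / 32) (δ₀ / 2)]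
  have h8 := hm₁ (Fin M) (by simp [hM]) _ (hA' v) _ (hD v)
  have h9 : dens (A' v ∩ ⋂ a, D v a) ≤ δ₀ * θ / 8 := by
    refine (dens_mono (B := Set.range fun (t : Fin M → K) j => some (t j)) ?_).trans ?_
    · rintro y ⟨hy, hyD⟩
      have hne : ∀ j, y j ≠ none := fun j => by
        have := (hA v.1).ne_none hy (fun a => Set.mem_iInter.1 hyD a) (e j)
        rwa [overwrite_apply_embedding] at this
      exact ⟨fun j => (y j).get (Option.isSome_iff_ne_none.2 (hne j)), funext fun j => by simp⟩
    · rw [dens_range_some, Nat.card_fin, ← hc]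
      refine le_trans ?_ hm₃.le
      exact pow_le_pow_of_le_one (by positivity) (div_le_one_of_le₀ (by linarith) (by positivity))
        (by simp [hM])
  have h10 := dens_inter_add_diff (A' v) (⋂ a, D v a)
  have h11 : (c + 1) * ε = δ₀ * θ / 8 := by rw [hε]; field_simp
  have h12 := dens_nonneg (⋂ a, D v a)
  have h13 : θ / 2 ≤ dens (⋂ a, D v a) := by linarith
  have h14 : δ₀ * (θ / 2) ≤ δ₀ * dens (⋂ a, D v a) := mul_le_mul_of_nonneg_left h13 hδ₀.le
  have h15 : 0 ≤ ε * dens (⋂ a, D v a) := by positivity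
  have h16 : 0 < δ₀ * θ := by positivity
  linarith

theorem DensityHalesJewett.option [Finite K] [Nonempty K] (hK : DensityHalesJewett K) :
    DensityHalesJewett (Option K) := by
  intro δ hδ
  by_contra hcon
  change ¬ LineFreeDensLT (Option K) δ at hcon
  have hmono : ∀ {x y : ℝ}, x ≤ y → LineFreeDensLT (Option K) x → LineFreeDensLT (Option K) y :=
    fun h ⟨m, hm⟩ => ⟨m, fun ι _ hι A hA => (hm ι hι A hA).trans_le h⟩
  set S := {x : ℝ | LineFreeDensLT (Option K) x} with hS
  have hlb : δ ∈ lowerBounds S := fun x hx => by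
    by_contra! h
    exact hcon (hmono h.le hx)
  have hne : S.Nonempty :=
    ⟨2, 0, fun ι _ _ A _ => (dens_le_one A).trans_lt (by norm_num)⟩
  refine false_of_lineFree_maximal hK (δ₀ := sInf S) (hδ.trans_le (le_csInf hne hlb)) ?_ ?_
  · intro ε hε
    obtain ⟨x, hx, hxε⟩ := exists_lt_of_csInf_lt hne (lt_add_of_pos_right (sInf S) hε)
    exact hmono hxε.le hx
  · intro ε hε h
    have := csInf_le ⟨δ, hlb⟩ h
    linarith

lemma DensityHalesJewett.of_equiv {K L : Type} [Finite K] [Finite L] (e : K ≃ L)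
    (hK : DensityHalesJewett K) : DensityHalesJewett L := by
  intro δ hδ
  obtain ⟨m, hm⟩ := hK δ hδ
  refine ⟨m, fun ι _ hι A hA => ?_⟩
  have := hm ι hι {x | (fun i => e (x i)) ∈ A} fun l => by
    obtain ⟨a, ha⟩ := hA (l.map e)
    refine ⟨e.symm a, ?_⟩
    convert ha using 2
    rw [← e.apply_symm_apply a, Line.map_apply, e.apply_symm_apply]
    rfl
  refine lt_of_eq_of_lt ?_ this
  rw [dens, ← avg_comp_equiv (Equiv.arrowCongr (Equiv.refl ι) e)]
  rfl

/-- The density Hales–Jewett theorem. -/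
theorem densityHalesJewett_fin_succ (d : ℕ) : DensityHalesJewett (Fin (d + 1)) := by
  induction d with
  | zero =>
    refine fun δ hδ => ⟨1, fun ι _ hι A hA => ?_⟩
    have : Nonempty ι := (Nat.card_pos_iff.1 hι).1
    obtain ⟨a, ha⟩ := hA (Line.diagonal (Fin 1) ι)
    have : A = ∅ := Set.eq_empty_of_forall_notMem fun x hx => ha (by
      convert hx using 1; exact funext fun i => Subsingleton.elim (α := Fin 1) _ _)
    rw [this, dens_empty]
    exact hδ
  | succ d ih => exact ih.option.of_equiv (finSuccEquiv (d + 1)).symm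

theorem densityHalesJewett (L : Type) [Finite L] [Nonempty L] : DensityHalesJewett L := by
  cases nonempty_fintype L
  obtain ⟨d, hd⟩ := Nat.exists_eq_succ_of_ne_zero (Fintype.card_ne_zero (α := L))
  exact (densityHalesJewett_fin_succ d).of_equiv
    ((finCongr hd.symm).trans (Fintype.equivFin L).symm)

end Induction

section VanDerCorput

open scoped BigOperators ComplexConjugate

/-- The additive character `x ↦ exp (2πix)` of the real line. -/
noncomputable def cexp (x : ℝ) : ℂ := Complex.exp (2 * Real.pi * x * Complex.I)

lemma cexp_add (x y : ℝ) : cexp (x + y) = cexp x * cexp y := by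
  rw [cexp, cexp, cexp, ← Complex.exp_add]
  push_cast
  ring_nf

lemma norm_cexp (x : ℝ) : ‖cexp x‖ = 1 := by
  rw [cexp, show (2 * Real.pi * x * Complex.I : ℂ) = ((2 * Real.pi * x : ℝ) : ℂ) * Complex.I by
    push_cast; ring]
  exact Complex.norm_exp_ofReal_mul_I _

lemma conj_cexp (x : ℝ) : conj (cexp x) = cexp (-x) := by
  rw [cexp, cexp, ← Complex.exp_conj]
  simp only [map_mul, Complex.conj_ofReal, Complex.conj_I, map_ofNat]
  push_cast
  ring_nf

lemma cexp_ne_one {x : ℝ} (hx : Irrational x) : cexp x ≠ 1 := by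
  rw [cexp, Ne, Complex.exp_eq_one_iff]
  rintro ⟨n, hn⟩
  have h2 : (2 * Real.pi * Complex.I : ℂ) ≠ 0 := by
    simp [Real.pi_ne_zero]
  have : (x : ℂ) = n := by
    apply mul_left_cancel₀ h2
    linear_combination hn
  exact hx.ne_int n (by exact_mod_cast this)

/-- The restriction to `ℕ` of a polynomial of degree `d + 1` with irrational leading
coefficient. -/
def IrrationalPoly (d : ℕ) (q : ℕ → ℝ) : Prop :=
  ∃ P : Polynomial ℝ, P.natDegree ≤ d + 1 ∧ Irrational (P.coeff (d + 1)) ∧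
    ∀ n : ℕ, q n = P.eval (n : ℝ)

lemma irrationalPoly_pow (d : ℕ) {α : ℝ} (hα : Irrational α) :
    IrrationalPoly d fun n => α * (n : ℝ) ^ (d + 1) :=
  ⟨Polynomial.C α * Polynomial.X ^ (d + 1), Polynomial.natDegree_C_mul_X_pow_le _ _, by simpa,
    fun n => by simp⟩

lemma IrrationalPoly.sub {d : ℕ} {q : ℕ → ℝ} (hq : IrrationalPoly (d + 1) q) {h h' : ℕ}
    (hh : h ≠ h') : IrrationalPoly d fun n => q (n + h) - q (n + h') := by
  obtain ⟨P, hdeg, hirr, hP⟩ := hq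
  have hcoeff : ∀ (r : ℝ), (Polynomial.taylor r P).coeff (d + 1) =
      P.coeff (d + 1) + (d + 2) * P.coeff (d + 2) * r := by
    intro r
    rw [Polynomial.taylor_coeff, Polynomial.eval_eq_sum_range' (n := 2)]
    · simp only [Finset.sum_range_succ, Finset.range_zero, Finset.sum_empty,
        Polynomial.hasseDeriv_coeff]
      rw [show 1 + (d + 1) = d + 1 + 1 by ring, Nat.choose_succ_self_right]
      simp only [zero_add, Nat.choose_self, Nat.cast_one, one_mul, pow_zero, mul_one, pow_one]
      push_cast
      ring_nf
    · have := Polynomial.natDegree_hasseDeriv_le P (d + 1)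
      omega
  have hcoeff' : ∀ (r : ℝ), (Polynomial.taylor r P).coeff (d + 2) = P.coeff (d + 2) := by
    intro r
    rw [Polynomial.taylor_coeff, Polynomial.eval_eq_sum_range' (n := 1)]
    · simp [Polynomial.hasseDeriv_coeff]
    · have := Polynomial.natDegree_hasseDeriv_le P (d + 2)
      omega
  refine ⟨Polynomial.taylor (h : ℝ) P - Polynomial.taylor (h' : ℝ) P, ?_, ?_, fun n => ?_⟩
  · rw [Polynomial.natDegree_le_iff_coeff_eq_zero]
    intro N hN
    rw [Polynomial.coeff_sub]
    rcases (show d + 2 ≤ N by omega).eq_or_lt with rfl | hlt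
    · rw [hcoeff', hcoeff', sub_self]
    · rw [Polynomial.coeff_eq_zero_of_natDegree_lt, Polynomial.coeff_eq_zero_of_natDegree_lt,
        sub_self] <;> rw [Polynomial.natDegree_taylor] <;> omega
  · rw [Polynomial.coeff_sub, hcoeff, hcoeff]
    have h0 : ((d + 2 : ℤ) * (h - h') : ℤ) ≠ 0 := by
      refine mul_ne_zero (by positivity) (sub_ne_zero.2 (by exact_mod_cast hh))
    have := hirr.intCast_mul h0
    convert this using 1
    push_cast
    ring
  · simp only [hP]
    rw [Polynomial.eval_sub, Polynomial.taylor_eval, Polynomial.taylor_eval]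
    push_cast
    simp only [add_comm]

lemma norm_sum_cexp_le {β : ℝ} (hβ : Irrational β) (c : ℝ) (N : ℕ) :
    ‖∑ n ∈ Finset.range N, cexp (c + β * n)‖ ≤ 2 / ‖cexp β - 1‖ := by
  have h : ∀ n : ℕ, cexp (c + β * n) = cexp c * cexp β ^ n := by
    intro n
    induction n with
    | zero => simp
    | succ n ih =>
      rw [pow_succ, ← mul_assoc, ← ih, ← cexp_add]
      push_cast
      ring_nf
  simp only [h]
  rw [← Finset.mul_sum, norm_mul, norm_cexp, one_mul, geom_sum_eq (cexp_ne_one hβ), norm_div]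
  gcongr
  refine (norm_sub_le _ _).trans ?_
  rw [norm_pow, norm_cexp]
  norm_num

lemma norm_sum_range_sub_shift_le {c : ℕ → ℂ} (hc : ∀ n, ‖c n‖ ≤ 1) (N h : ℕ) :
    ‖∑ n ∈ Finset.range N, c n - ∑ n ∈ Finset.range N, c (n + h)‖ ≤ 2 * h := by
  have h1 := Finset.sum_range_add c N h
  have h2 := Finset.sum_range_add c h N
  have h3 : ∑ n ∈ Finset.range N, c n - ∑ n ∈ Finset.range N, c (n + h) =
      ∑ n ∈ Finset.range h, c n - ∑ n ∈ Finset.range h, c (N + n) := by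
    rw [add_comm h N, h1] at h2
    simp only [add_comm _ h]
    linear_combination h2
  have hb : ∀ m, ‖∑ n ∈ Finset.range h, c (m + n)‖ ≤ h := fun m => by
    simpa using norm_sum_le_of_le (Finset.range h) fun n _ => hc (m + n)
  rw [h3]
  refine (norm_sub_le _ _).trans ?_
  have := hb 0
  simp only [zero_add] at this
  linarith [hb N]

/-- Smoothing a bounded sum by averaging over shifts. -/
lemma norm_sum_range_le_shift {c : ℕ → ℂ} (hc : ∀ n, ‖c n‖ ≤ 1) (N H : ℕ) :
    H * ‖∑ n ∈ Finset.range N, c n‖ ≤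
      2 * H ^ 2 + ∑ n ∈ Finset.range N, ‖∑ h ∈ Finset.range H, c (n + h)‖ := by
  have h1 : (H : ℂ) * ∑ n ∈ Finset.range N, c n =
      ∑ h ∈ Finset.range H, (∑ n ∈ Finset.range N, c n - ∑ n ∈ Finset.range N, c (n + h)) +
      ∑ n ∈ Finset.range N, ∑ h ∈ Finset.range H, c (n + h) := by
    rw [Finset.sum_sub_distrib, Finset.sum_comm (s := Finset.range N)]
    simp
  calc (H : ℝ) * ‖∑ n ∈ Finset.range N, c n‖ = ‖(H : ℂ) * ∑ n ∈ Finset.range N, c n‖ := by simp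
    _ ≤ _ := by
      rw [h1]
      refine (norm_add_le _ _).trans (add_le_add ?_ (norm_sum_le _ _))
      refine (norm_sum_le_of_le _ (f := fun h : ℕ => ∑ n ∈ Finset.range N, c n -
        ∑ n ∈ Finset.range N, c (n + h)) (n := fun _ => (2 * H : ℝ)) fun h hh => ?_).trans ?_
      · refine (norm_sum_range_sub_shift_le hc N h).trans ?_
        have := (Finset.mem_range.1 hh).le
        gcongr
      · simp only [Finset.sum_const, Finset.card_range, nsmul_eq_mul]
        apply le_of_eq
        ring

/-- The van der Corput inequality for families of bounded sequences. -/
lemma sum_norm_sum_range_le {G : Type} [Fintype G] {c : ℕ → G → ℂ} (hc : ∀ n x, ‖c n x‖ ≤ 1)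
    {N H : ℕ} {ε : ℝ}
    (hcorr : ∀ h ∈ Finset.range H, ∀ h' ∈ Finset.range H, h ≠ h' →
      ‖∑ n ∈ Finset.range N, ∑ x, c (n + h) x * conj (c (n + h') x)‖ ≤
        ε * (N * Fintype.card G)) (hε : 0 ≤ ε) :
    H * ∑ x, ‖∑ n ∈ Finset.range N, c n x‖ ≤
      2 * H ^ 2 * Fintype.card G + N * Fintype.card G * √(H + H ^ 2 * ε) := by
  set g : ℝ := (Fintype.card G : ℝ) with hg
  have hg0 : 0 ≤ g := Nat.cast_nonneg _
  have h1 : H * ∑ x, ‖∑ n ∈ Finset.range N, c n x‖ ≤ 2 * H ^ 2 * g +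
      ∑ x, ∑ n ∈ Finset.range N, ‖∑ h ∈ Finset.range H, c (n + h) x‖ := by
    rw [Finset.mul_sum]
    refine (Finset.sum_le_sum fun x _ => norm_sum_range_le_shift (fun n => hc n x) N H).trans ?_
    rw [Finset.sum_add_distrib]
    simp [hg, mul_comm]
  refine h1.trans (add_le_add le_rfl ?_)
  have hsq : ∑ x, ∑ n ∈ Finset.range N, ‖∑ h ∈ Finset.range H, c (n + h) x‖ ^ 2 ≤
      N * g * (H + H ^ 2 * ε) := by
    have hexp : ((∑ x, ∑ n ∈ Finset.range N, ‖∑ h ∈ Finset.range H, c (n + h) x‖ ^ 2 : ℝ) : ℂ) =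
        ∑ h ∈ Finset.range H, ∑ h' ∈ Finset.range H, ∑ n ∈ Finset.range N, ∑ x,
          c (n + h) x * conj (c (n + h') x) := by
      push_cast
      simp only [← Complex.mul_conj', map_sum, Finset.sum_mul_sum]
      rw [Finset.sum_comm]
      simp only [Finset.sum_comm (s := Finset.univ) (t := Finset.range H)]
      rw [Finset.sum_comm]
      refine Finset.sum_congr rfl fun h _ => ?_
      rw [Finset.sum_comm]
    have hnn : 0 ≤ ∑ x, ∑ n ∈ Finset.range N, ‖∑ h ∈ Finset.range H, c (n + h) x‖ ^ 2 := by
      positivity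
    rw [← Real.norm_of_nonneg hnn, ← Complex.norm_real, hexp]
    have hrow : ∀ h ∈ Finset.range H, ‖∑ h' ∈ Finset.range H, ∑ n ∈ Finset.range N, ∑ x,
        c (n + h) x * conj (c (n + h') x)‖ ≤ N * g * (1 + H * ε) := by
      intro h hh
      rw [← Finset.add_sum_erase _ _ hh]
      have hdiag : ‖∑ n ∈ Finset.range N, ∑ x, c (n + h) x * conj (c (n + h) x)‖ ≤ N * g := by
        refine (norm_sum_le_of_le (n := fun _ => g) _ fun n _ => ?_).trans (by simp)
        refine (norm_sum_le_of_le (n := fun _ => (1 : ℝ)) _ fun x _ => ?_).trans (by simp [hg])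
        rw [norm_mul, RCLike.norm_conj]
        exact mul_le_one₀ (hc _ _) (norm_nonneg _) (hc _ _)
      have hoff : ‖∑ h' ∈ (Finset.range H).erase h, ∑ n ∈ Finset.range N, ∑ x,
          c (n + h) x * conj (c (n + h') x)‖ ≤ H * (ε * (N * g)) := by
        refine (norm_sum_le_of_le (n := fun _ => ε * (N * g)) _ fun h' hh' =>
          hcorr h hh h' (Finset.mem_of_mem_erase hh') (Finset.ne_of_mem_erase hh').symm).trans ?_
        rw [Finset.sum_const, nsmul_eq_mul]
        refine mul_le_mul_of_nonneg_right ?_ (by positivity)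
        have := Finset.card_erase_le (s := Finset.range H) (a := h)
        rw [Finset.card_range] at this
        exact_mod_cast this
      refine (norm_add_le _ _).trans ?_
      linarith
    refine (norm_sum_le_of_le _ hrow).trans ?_
    simp only [Finset.sum_const, Finset.card_range, nsmul_eq_mul]
    apply le_of_eq
    ring
  have hcs : (∑ x, ∑ n ∈ Finset.range N, ‖∑ h ∈ Finset.range H, c (n + h) x‖) ^ 2 ≤
      (N * g) * ∑ x, ∑ n ∈ Finset.range N, ‖∑ h ∈ Finset.range H, c (n + h) x‖ ^ 2 := by
    simp only [← Finset.sum_product']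
    refine (sq_sum_le_card_mul_sum_sq).trans_eq ?_
    rw [Finset.card_product, Finset.card_range, Finset.card_univ, hg]
    push_cast
    ring
  refine (le_abs_self _).trans (abs_le_of_sq_le_sq ?_ (by positivity))
  rw [mul_pow, Real.sq_sqrt (by positivity)]
  refine hcs.trans ?_
  nlinarith [mul_le_mul_of_nonneg_left hsq (show 0 ≤ N * g by positivity)]

/-- A polynomial phase of degree `d + 1` is uniformly orthogonal to the averages of `d + 1`
functions along arithmetic progressions in finite abelian groups. -/
theorem exists_norm_sum_cexp_mul_le (d : ℕ) : ∀ q, IrrationalPoly d q → ∀ ε : ℝ, 0 < ε →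
    ∃ N₀ : ℕ, ∀ N ≥ N₀, ∀ (G : Type) [AddCommGroup G] [Fintype G] (f : Fin (d + 1) → G → ℂ)
      (g : Fin (d + 1) → G), (∀ i x, ‖f i x‖ ≤ 1) →
      ‖∑ n ∈ Finset.range N, cexp (q n) * ∑ x, ∏ i, f i (x + n • g i)‖ ≤
        ε * (N * Fintype.card G) := by
  induction d with
  | zero =>
    rintro q ⟨P, hdeg, hirr, hP⟩ ε hε
    obtain ⟨N₀, hN₀⟩ := exists_nat_ge (2 / ‖cexp (P.coeff 1) - 1‖ / ε)
    refine ⟨N₀, fun N hN G _ _ f g hf => ?_⟩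
    have hsum : ∀ n : ℕ, ∑ x, ∏ i, f i (x + n • g i) = ∑ x, f 0 x := by
      intro n
      rw [Finset.sum_congr rfl fun x _ => Fin.prod_univ_one fun i => f i (x + n • g i)]
      exact Equiv.sum_comp (Equiv.addRight (n • g 0)) (f 0)
    have hq : ∀ n, q n = P.coeff 0 + P.coeff 1 * n := by
      intro n
      rw [hP, Polynomial.eval_eq_sum_range' (n := 2) (by omega)]
      simp [Finset.sum_range_succ]
    simp only [hsum, hq]
    rw [← Finset.sum_mul, norm_mul]
    have h1 := norm_sum_cexp_le (by simpa using hirr) (P.coeff 0) N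
    have h2 : ‖∑ x, f 0 x‖ ≤ Fintype.card G := by
      refine (norm_sum_le_of_le (n := fun _ => (1 : ℝ)) _ fun x _ => hf 0 x).trans (by simp)
    have h3 : 2 / ‖cexp (P.coeff 1) - 1‖ ≤ ε * N := by
      rw [div_le_iff₀ hε] at hN₀
      have : (N₀ : ℝ) ≤ N := by exact_mod_cast hN
      nlinarith
    rw [← mul_assoc]
    exact mul_le_mul (h1.trans h3) h2 (norm_nonneg _) (by positivity)
  | succ d ih =>
    intro q hq ε hε
    obtain ⟨H, hH⟩ := exists_nat_ge (8 / ε ^ 2 + 1)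
    have hH1 : (1 : ℝ) ≤ H := le_trans (by simp; positivity) hH
    have hH2 : 8 ≤ ε ^ 2 * H := by
      have : 8 / ε ^ 2 ≤ H := by linarith
      rwa [div_le_iff₀ (by positivity), mul_comm] at this
    have hcorr : ∃ N₁ : ℕ, ∀ h ∈ Finset.range H, ∀ h' ∈ Finset.range H, h ≠ h' →
        ∀ N ≥ N₁, ∀ (G : Type) [AddCommGroup G] [Fintype G] (f : Fin (d + 1) → G → ℂ)
        (g : Fin (d + 1) → G), (∀ i x, ‖f i x‖ ≤ 1) →
        ‖∑ n ∈ Finset.range N, cexp (q (n + h) - q (n + h')) * ∑ x, ∏ i, f i (x + n • g i)‖ ≤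
          ε ^ 2 / 8 * (N * Fintype.card G) := by
      have : ∀ p : ℕ × ℕ, ∃ N₁ : ℕ, p.1 ≠ p.2 →
          ∀ N ≥ N₁, ∀ (G : Type) [AddCommGroup G] [Fintype G] (f : Fin (d + 1) → G → ℂ)
          (g : Fin (d + 1) → G), (∀ i x, ‖f i x‖ ≤ 1) →
          ‖∑ n ∈ Finset.range N, cexp (q (n + p.1) - q (n + p.2)) *
            ∑ x, ∏ i, f i (x + n • g i)‖ ≤ ε ^ 2 / 8 * (N * Fintype.card G) := by
        intro p
        by_cases hp : p.1 = p.2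
        · exact ⟨0, fun h => absurd hp h⟩
        · obtain ⟨N₁, hN₁⟩ := ih _ (hq.sub hp) (ε ^ 2 / 8) (by positivity)
          exact ⟨N₁, fun _ => hN₁⟩
      choose N₁ hN₁ using this
      refine ⟨(Finset.range H ×ˢ Finset.range H).sup N₁, fun h hh h' hh' hne N hN => ?_⟩
      exact hN₁ (h, h') hne N
        ((Finset.le_sup (f := N₁) (Finset.mk_mem_product hh hh')).trans hN)
    obtain ⟨N₁, hN₁⟩ := hcorr
    obtain ⟨N₂, hN₂⟩ := exists_nat_ge (4 * H / ε)
    refine ⟨max N₁ N₂, fun N hN G _ _ f g hf => ?_⟩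
    set c : ℕ → G → ℂ := fun n x =>
      cexp (q n) * ∏ i : Fin (d + 1), f i.succ (x + n • (g i.succ - g 0)) with hcdef
    have hprod : ∀ {x : G} {γ : Fin (d + 1) → G}, ‖∏ i : Fin (d + 1), f i.succ (x + γ i)‖ ≤ 1 := by
      intro x γ
      rw [norm_prod]
      exact Finset.prod_le_one (fun _ _ => norm_nonneg _) fun i _ => hf _ _
    have hc : ∀ n x, ‖c n x‖ ≤ 1 := fun n x => by
      rw [hcdef]
      simp only
      rw [norm_mul, norm_cexp, one_mul]
      exact hprod
    have hcc := sum_norm_sum_range_le hc (N := N) (H := H) (ε := ε ^ 2 / 8)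
      (fun h hh h' hh' hne => by
        have := hN₁ h hh h' hh' hne N ((le_max_left _ _).trans hN) G
          (fun i y => f i.succ (y + h • (g i.succ - g 0)) *
            conj (f i.succ (y + h' • (g i.succ - g 0)))) (fun i => g i.succ - g 0)
          (fun i x => by
            rw [norm_mul, RCLike.norm_conj]
            exact mul_le_one₀ (hf _ _) (norm_nonneg _) (hf _ _))
        refine le_of_eq_of_le ?_ this
        congr 1
        refine Finset.sum_congr rfl fun n _ => ?_
        rw [Finset.mul_sum]
        refine Finset.sum_congr rfl fun x _ => ?_
        rw [Finset.prod_mul_distrib, sub_eq_add_neg, cexp_add, hcdef]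
        simp only [map_mul, map_prod, conj_cexp, add_nsmul, add_assoc]
        ring) (by positivity)
    have hmain : ‖∑ n ∈ Finset.range N, cexp (q n) * ∑ x, ∏ i, f i (x + n • g i)‖ ≤
        ∑ x, ‖∑ n ∈ Finset.range N, c n x‖ := by
      have hshift : ∀ n : ℕ, ∑ x, ∏ i, f i (x + n • g i) =
          ∑ x, f 0 x * ∏ i : Fin (d + 1), f i.succ (x + n • (g i.succ - g 0)) := by
        intro n
        rw [← Equiv.sum_comp (Equiv.addRight (n • g 0))
          (fun x => f 0 x * ∏ i : Fin (d + 1), f i.succ (x + n • (g i.succ - g 0)))]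
        refine Finset.sum_congr rfl fun x _ => ?_
        rw [Fin.prod_univ_succ]
        simp only [Equiv.coe_addRight, nsmul_sub]
        congr 1
        refine Finset.prod_congr rfl fun i _ => ?_
        congr 1
        abel
      have : ∑ n ∈ Finset.range N, cexp (q n) * ∑ x, ∏ i, f i (x + n • g i) =
          ∑ x, f 0 x * ∑ n ∈ Finset.range N, c n x := by
        simp only [hshift, Finset.mul_sum]
        rw [Finset.sum_comm]
        refine Finset.sum_congr rfl fun x _ => Finset.sum_congr rfl fun n _ => ?_
        rw [hcdef]
        ring
      rw [this]
      refine norm_sum_le_of_le _ fun x _ => ?_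
      rw [norm_mul]
      exact mul_le_of_le_one_left (norm_nonneg _) (hf _ _)
    refine hmain.trans ?_
    have hsqrt : √(H + H ^ 2 * (ε ^ 2 / 8)) ≤ H * (ε / 2) := by
      rw [Real.sqrt_le_left (by positivity)]
      nlinarith
    have hNN : 4 * H ≤ ε * N := by
      rw [div_le_iff₀ hε] at hN₂
      have : (N₂ : ℝ) ≤ N := by exact_mod_cast (le_max_right _ _).trans hN
      nlinarith
    have hHpos : (0 : ℝ) < H := by linarith
    refine le_of_mul_le_mul_left ?_ hHpos
    refine hcc.trans ?_
    set γ : ℝ := (Fintype.card G : ℝ)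
    have hγ : 0 ≤ γ := Nat.cast_nonneg _
    have e1 : N * γ * √(H + H ^ 2 * (ε ^ 2 / 8)) ≤ N * γ * (H * (ε / 2)) :=
      mul_le_mul_of_nonneg_left hsqrt (by positivity)
    have e2 : 4 * H * (H * γ) ≤ ε * N * (H * γ) := mul_le_mul_of_nonneg_right hNN (by positivity)
    linarith

end VanDerCorput

section Recurrence

open Combinatorics
open scoped ComplexConjugate

variable {X : Type*} [MeasurableSpace X] {μ : Measure X} {d : ℕ}

lemma comp_iterate_comm {Y : Type*} {f g : Y → Y} (h : f ∘ g = g ∘ f) (m n : ℕ) :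
    f^[m] ∘ g^[n] = g^[n] ∘ f^[m] :=
  (((show Function.Commute f g from congrFun h).iterate_left m).iterate_right n :
    Function.Semiconj f^[m] g^[n] g^[n]).comp_eq

/-- Commuting measure-preserving maps generate an action of `ℕ ^ d`. -/
lemma exists_measurePreserving_action {T : Fin d → X → X}
    (hmp : ∀ i, MeasurePreserving (T i) μ μ) (hcomm : ∀ i j, T i ∘ T j = T j ∘ T i) :
    ∃ S : (Fin d → ℕ) → X → X, (∀ v, MeasurePreserving (S v) μ μ) ∧
      ∀ v i n, S (v + Pi.single i n) = (T i)^[n] ∘ S v := by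
  let S : List (Fin d) → (Fin d → ℕ) → X → X := fun l v =>
    l.foldr (fun i g => (T i)^[v i] ∘ g) id
  have hmpS : ∀ l v, MeasurePreserving (S l v) μ μ := by
    intro l v
    induction l with
    | nil => exact MeasurePreserving.id μ
    | cons i l ih => exact ((hmp i).iterate _).comp ih
  have hnotMem : ∀ l v i n, i ∉ l → S l (v + Pi.single i n) = S l v := by
    intro l v i n hi
    induction l with
    | nil => rfl
    | cons j l ih =>
      rw [List.mem_cons, not_or] at hi
      change (T j)^[(v + Pi.single i n : Fin d → ℕ) j] ∘ S l (v + Pi.single i n) =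
        (T j)^[v j] ∘ S l v
      rw [ih hi.2, Pi.add_apply, Pi.single_eq_of_ne (Ne.symm hi.1), add_zero]
  have hmem : ∀ l v i n, l.Nodup → i ∈ l → S l (v + Pi.single i n) = (T i)^[n] ∘ S l v := by
    intro l v i n hl hi
    induction l with
    | nil => exact absurd hi List.not_mem_nil
    | cons j l ih =>
      rw [List.nodup_cons] at hl
      change (T j)^[(v + Pi.single i n : Fin d → ℕ) j] ∘ S l (v + Pi.single i n) =
        (T i)^[n] ∘ (T j)^[v j] ∘ S l v
      rcases eq_or_ne i j with rfl | hij
      · rw [hnotMem l v i n hl.1, Pi.add_apply, Pi.single_eq_same, add_comm,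
          Function.iterate_add, Function.comp_assoc]
      · rw [ih hl.2 ((List.mem_cons.1 hi).resolve_left hij), Pi.add_apply,
          Pi.single_eq_of_ne hij.symm, add_zero, ← Function.comp_assoc, ← Function.comp_assoc,
          comp_iterate_comm (hcomm j i)]
  exact ⟨S (List.finRange d), hmpS _, fun v i n =>
    hmem _ v i n (List.nodup_finRange d) (List.mem_finRange i)⟩

/-- The set of points of `A` returning to `A` under the `n`-th powers of all transformations. -/
def returnSet (T : Fin d → X → X) (A : Set X) (n : ℕ) : Set X := A ∩ ⋂ i, (T i)^[n] ⁻¹' A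

lemma measurableSet_returnSet {T : Fin d → X → X} (hmp : ∀ i, MeasurePreserving (T i) μ μ)
    {A : Set X} (hA : MeasurableSet A) (n : ℕ) : MeasurableSet (returnSet T A n) :=
  hA.inter (MeasurableSet.iInter fun i => ((hmp i).iterate n).measurable hA)

lemma returnSet_iterate {X : Type*} (T : Fin d → X → X) (A : Set X) (n r : ℕ) :
    returnSet (fun i => (T i)^[n]) A r = returnSet T A (n * r) := by
  simp only [returnSet, Function.iterate_mul]

lemma ZMod.card_filter_val_lt (N : ℕ) [NeZero (2 * N)] :
    (Finset.univ.filter fun z : ZMod (2 * N) => z.val < N).card = N := by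
  conv_rhs => rw [← Finset.card_range N]
  refine Finset.card_nbij' ZMod.val (fun n => (n : ZMod (2 * N))) ?_ ?_ ?_ ?_
  · intro z hz
    simpa using hz
  · intro n hn
    have : n < N := by simpa using hn
    simpa [ZMod.val_natCast_of_lt (show n < 2 * N by omega)] using this
  · intro z _
    simp
  · intro n hn
    have : n < N := by simpa using hn
    exact ZMod.val_natCast_of_lt (show n < 2 * N by omega)

/-- Multiple correlation sequences of `d` commuting transformations are orthogonal to polynomial
phases of degree `d + 1`. -/
lemma exists_norm_sum_cexp_mul_measure_le [IsProbabilityMeasure μ] {T : Fin d → X → X}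
    (hmp : ∀ i, MeasurePreserving (T i) μ μ) (hcomm : ∀ i j, T i ∘ T j = T j ∘ T i)
    {A : Set X} (hA : MeasurableSet A) {β : ℝ} (hβ : Irrational β) {ε : ℝ} (hε : 0 < ε) :
    ∃ N₀ : ℕ, ∀ N ≥ N₀, ‖∑ n ∈ Finset.range N,
      cexp (β * (n : ℝ) ^ (d + 1)) * (μ.real (returnSet T A n) : ℂ)‖ ≤ ε * N := by
  classical
  obtain ⟨S, hS, hST⟩ := exists_measurePreserving_action hmp hcomm
  obtain ⟨N₀, hN₀⟩ := exists_norm_sum_cexp_mul_le d _ (irrationalPoly_pow d hβ) (ε / 2 ^ d)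
    (by positivity)
  refine ⟨max N₀ 1, fun N hN => ?_⟩
  have hN1 : 1 ≤ N := (le_max_right _ _).trans hN
  have : NeZero (2 * N) := ⟨by omega⟩
  let val : (Fin d → ZMod (2 * N)) → Fin d → ℕ := fun v i => (v i).val
  let box : Finset (Fin d → ZMod (2 * N)) :=
    Fintype.piFinset fun _ => Finset.univ.filter fun z : ZMod (2 * N) => z.val < N
  have hbox : ∀ {v}, v ∈ box ↔ ∀ i, (v i).val < N := by simp [box]
  have hcard : (box.card : ℂ) = (N : ℂ) ^ d := by
    simp [box, Fintype.card_piFinset, ZMod.card_filter_val_lt]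
  have hval : ∀ v ∈ box, ∀ n < N, ∀ i,
      val (v + n • Pi.single i (1 : ZMod (2 * N))) = val v + Pi.single i n := by
    intro v hv n hn i
    funext j
    have hvj := hbox.1 hv j
    rcases eq_or_ne j i with rfl | hj
    · have h1 : ((n : ZMod (2 * N))).val = n := ZMod.val_natCast_of_lt (by omega)
      simp only [val, Pi.add_apply, Pi.smul_apply, Pi.single_eq_same]
      rw [nsmul_eq_mul, mul_one]
      rw [ZMod.val_add_of_lt, h1]
      rw [h1]
      omega
    · simp [val, hj]
  let f : X → Fin (d + 1) → (Fin d → ZMod (2 * N)) → ℂ := fun x =>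
    Fin.cons (fun v => if v ∈ box then A.indicator 1 (S (val v) x) else 0)
      fun _ v => A.indicator 1 (S (val v) x)
  let g : Fin (d + 1) → Fin d → ZMod (2 * N) := Fin.cons 0 fun i => Pi.single i 1
  have hind : ∀ y, ‖A.indicator (1 : X → ℂ) y‖ ≤ 1 := fun y => by
    by_cases h : y ∈ A <;> simp [h]
  have hf : ∀ x i v, ‖f x i v‖ ≤ 1 := by
    intro x i v
    refine Fin.cases ?_ (fun i => ?_) i
    · simp only [f, Fin.cons_zero]
      split_ifs
      · exact hind _
      · simp
    · exact hind _
  have hprod : ∀ x, ∀ n ∈ Finset.range N, ∑ v, ∏ i, f x i (v + n • g i) =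
      ∑ v ∈ box, (returnSet T A n).indicator 1 (S (val v) x) := by
    intro x n hn
    rw [← Finset.sum_subset (Finset.subset_univ box)]
    · refine Finset.sum_congr rfl fun v hv => ?_
      rw [Fin.prod_univ_succ]
      simp only [f, g, Fin.cons_zero, Fin.cons_succ, smul_zero, add_zero, if_pos hv]
      simp only [hval v hv n (Finset.mem_range.1 hn), hST, Function.comp_apply]
      by_cases h0 : S (val v) x ∈ A
      · by_cases h1 : ∀ i, (T i)^[n] (S (val v) x) ∈ A
        · have : S (val v) x ∈ returnSet T A n := ⟨h0, Set.mem_iInter.2 h1⟩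
          simp [this, h0, h1]
        · have : S (val v) x ∉ returnSet T A n := fun h => h1 (Set.mem_iInter.1 h.2)
          rw [Set.indicator_of_notMem this]
          push Not at h1
          obtain ⟨i, hi⟩ := h1
          rw [Finset.prod_eq_zero (Finset.mem_univ i) (Set.indicator_of_notMem hi _), mul_zero]
      · have : S (val v) x ∉ returnSet T A n := fun h => h0 h.1
        simp [this, h0]
    · intro v _ hv
      rw [Fin.prod_univ_succ]
      simp [f, g, hv]
  have hInt : ∀ n v, Integrable (fun x => (returnSet T A n).indicator (1 : X → ℂ) (S (val v) x)) μ ∧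
      ∫ x, (returnSet T A n).indicator (1 : X → ℂ) (S (val v) x) ∂μ =
        (μ.real (returnSet T A n) : ℂ) := by
    intro n v
    have hm := measurableSet_returnSet hmp hA n
    have hm' := (hS (val v)).measurable hm
    have heq : (fun x => (returnSet T A n).indicator (1 : X → ℂ) (S (val v) x)) =
      (S (val v) ⁻¹' returnSet T A n).indicator fun _ => 1 := rfl
    rw [heq]
    refine ⟨(integrable_const _).indicator hm', ?_⟩
    rw [integral_indicator_const _ hm', measureReal_def, (hS (val v)).measure_preimage
      hm.nullMeasurableSet, ← measureReal_def]
    simp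
  have hkey : (N : ℂ) ^ d * ∑ n ∈ Finset.range N,
      cexp (β * (n : ℝ) ^ (d + 1)) * (μ.real (returnSet T A n) : ℂ) =
      ∫ x, ∑ n ∈ Finset.range N, cexp (β * (n : ℝ) ^ (d + 1)) *
        ∑ v ∈ box, (returnSet T A n).indicator (1 : X → ℂ) (S (val v) x) ∂μ := by
    rw [integral_finsetSum _ fun n _ =>
      (integrable_finsetSum _ fun v _ => (hInt n v).1).const_mul _, Finset.mul_sum]
    refine Finset.sum_congr rfl fun n _ => ?_
    rw [integral_const_mul, integral_finsetSum _ fun v _ => (hInt n v).1]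
    simp only [(hInt n _).2, Finset.sum_const, nsmul_eq_mul, hcard]
    ring
  have hbound : ‖(N : ℂ) ^ d * ∑ n ∈ Finset.range N,
      cexp (β * (n : ℝ) ^ (d + 1)) * (μ.real (returnSet T A n) : ℂ)‖ ≤
      ε / 2 ^ d * (N * (2 * N) ^ d) := by
    rw [hkey]
    refine (norm_integral_le_of_norm_le_const (C := ε / 2 ^ d * (N * (2 * N) ^ d))
      (Filter.Eventually.of_forall fun x => ?_)).trans (by simp)
    have := hN₀ N ((le_max_left _ _).trans hN) _ (f x) g (hf x)
    rw [Finset.sum_congr rfl fun n hn => by rw [hprod x n hn]] at this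
    simpa [ZMod.card] using this
  rw [norm_mul, norm_pow, Complex.norm_natCast] at hbound
  have hNpos : (0 : ℝ) < (N : ℝ) ^ d := by positivity
  refine le_of_mul_le_mul_left (hbound.trans_eq ?_) hNpos
  rw [mul_pow]
  field_simp

/-- The number of occurrences of each letter other than `none`. -/
def letterCount {m : ℕ} (w : Fin m → Option (Fin d)) (i : Fin d) : ℕ :=
  (Finset.univ.filter fun j => w j = some i).card

/-- The number of active coordinates of a line. -/
def lineSize {m : ℕ} (l : Line (Option (Fin d)) (Fin m)) : ℕ :=
  (Finset.univ.filter fun j => l.idxFun j = none).card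

lemma letterCount_line_some {m : ℕ} (l : Line (Option (Fin d)) (Fin m)) (i : Fin d) :
    letterCount (l (some i)) = letterCount (l none) + Pi.single i (lineSize l) := by
  funext i'
  rcases eq_or_ne i' i with rfl | hi
  · simp only [letterCount, lineSize, Pi.add_apply, Pi.single_eq_same]
    rw [← Finset.card_union_of_disjoint]
    · congr 1
      ext j
      simp only [Finset.mem_union, Finset.mem_filter, Finset.mem_univ, true_and]
      rw [Line.coe_apply, Line.coe_apply]
      cases h : l.idxFun j <;> simp
    · rw [Finset.disjoint_left]
      intro j hj hj'
      simp only [Finset.mem_filter, Finset.mem_univ, true_and] at hj hj'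
      simp [Line.coe_apply, hj'] at hj
  · simp only [letterCount, Pi.add_apply, Pi.single_eq_of_ne hi, add_zero]
    congr 1
    ext j
    simp only [Finset.mem_filter, Finset.mem_univ, true_and]
    rw [Line.coe_apply, Line.coe_apply]
    cases h : l.idxFun j <;> simp [hi.symm]

lemma lineSize_mem_Icc {m : ℕ} (l : Line (Option (Fin d)) (Fin m)) :
    lineSize l ∈ Finset.Icc 1 m := by
  rw [Finset.mem_Icc]
  constructor
  · obtain ⟨j, hj⟩ := l.proper
    exact Finset.card_pos.2 ⟨j, by simpa using hj⟩
  · exact (Finset.card_filter_le _ _).trans_eq (by simp)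

/-- Uniform multiple recurrence along multiples of bounded length. -/
lemma exists_forall_exists_le_measure_returnSet [IsProbabilityMeasure μ] {T : Fin d → X → X}
    (hmp : ∀ i, MeasurePreserving (T i) μ μ) (hcomm : ∀ i j, T i ∘ T j = T j ∘ T i)
    {A : Set X} (hA : MeasurableSet A) (hApos : 0 < μ A) :
    ∃ (m : ℕ) (c : ℝ), 0 < c ∧ ∀ r : ℕ, ∃ n ∈ Finset.Icc 1 m,
      c ≤ μ.real (returnSet T A (n * r)) := by
  classical
  obtain ⟨S, hS, hST⟩ := exists_measurePreserving_action hmp hcomm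
  set δ := μ.real A with hδ
  have hδ0 : 0 < δ := ENNReal.toReal_pos hApos.ne' (measure_ne_top _ _)
  obtain ⟨m, hm⟩ := densityHalesJewett (Option (Fin d)) (δ / 2) (half_pos hδ0)
  let := Fintype.ofFinite (Line (Option (Fin d)) (Fin m))
  set q := Fintype.card (Line (Option (Fin d)) (Fin m)) with hq
  refine ⟨m, δ / 2 / (q + 1), by positivity, fun r => ?_⟩
  by_contra! hcon
  have hpt : ∀ x,
      (∑ w : Fin m → Option (Fin d), A.indicator (1 : X → ℝ) (S (r • letterCount w) x)) /
      Nat.card (Fin m → Option (Fin d)) ≤ δ / 2 +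
      ∑ l : Line (Option (Fin d)) (Fin m), (returnSet T A (lineSize l * r)).indicator (1 : X → ℝ)
        (S (r • letterCount (l none)) x) := by
    intro x
    rw [← avg_eq_sum_div]
    change dens {w : Fin m → Option (Fin d) | S (r • letterCount w) x ∈ A} ≤ _
    have hnn : ∀ l ∈ (Finset.univ : Finset (Line (Option (Fin d)) (Fin m))),
        0 ≤ (returnSet T A (lineSize l * r)).indicator (1 : X → ℝ)
          (S (r • letterCount (l none)) x) := fun l _ => Set.indicator_nonneg (by simp) _
    by_cases hfree : LineFree {w : Fin m → Option (Fin d) | S (r • letterCount w) x ∈ A}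
    · linarith [hm (Fin m) (by simp) _ hfree, Finset.sum_nonneg hnn]
    · simp only [LineFree, not_forall, not_exists, not_not] at hfree
      obtain ⟨l, hl⟩ := hfree
      have hmem : S (r • letterCount (l none)) x ∈ returnSet T A (lineSize l * r) := by
        refine ⟨hl none, Set.mem_iInter.2 fun i => ?_⟩
        have := hl (some i)
        rw [Set.mem_ofPred_eq, letterCount_line_some, smul_add, ← Pi.single_smul, hST,
          smul_eq_mul, mul_comm] at this
        exact this
      have := Finset.single_le_sum hnn (Finset.mem_univ l)
      rw [Set.indicator_of_mem hmem, Pi.one_apply] at this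
      linarith [dens_le_one {w : Fin m → Option (Fin d) | S (r • letterCount w) x ∈ A}]
  have hInt : ∀ (B : Set X) (_ : MeasurableSet B) v,
      Integrable (fun x => B.indicator (1 : X → ℝ) (S v x)) μ ∧
      ∫ x, B.indicator (1 : X → ℝ) (S v x) ∂μ = μ.real B := by
    intro B hB v
    have hm' := (hS v).measurable hB
    have heq : (fun x => B.indicator (1 : X → ℝ) (S v x)) = (S v ⁻¹' B).indicator fun _ => 1 := rfl
    rw [heq]
    refine ⟨(integrable_const _).indicator hm', ?_⟩
    rw [integral_indicator_const _ hm', measureReal_def, (hS v).measure_preimage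
      hB.nullMeasurableSet, ← measureReal_def]
    simp
  have hB := fun n => measurableSet_returnSet hmp hA n
  have hle := integral_mono (μ := μ)
    ((integrable_finsetSum _ fun w _ => (hInt A hA _).1).div_const _)
    ((integrable_const _).add (integrable_finsetSum _ fun l _ => (hInt _ (hB _) _).1)) hpt
  rw [integral_div, integral_finsetSum _ fun w _ => (hInt A hA _).1,
    integral_add' (integrable_const _) (integrable_finsetSum _ fun l _ => (hInt _ (hB _) _).1),
    integral_finsetSum _ fun l _ => (hInt _ (hB _) _).1] at hle
  simp only [(hInt A hA _).2, (hInt _ (hB _) _).2] at hle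
  rw [Finset.sum_const, nsmul_eq_mul, Finset.card_univ, ← Nat.card_eq_fintype_card,
    mul_div_cancel_left₀ _ (Nat.cast_ne_zero.2 Nat.card_pos.ne'), integral_const] at hle
  have hsum : ∑ l : Line (Option (Fin d)) (Fin m), μ.real (returnSet T A (lineSize l * r)) ≤
      ∑ _l : Line (Option (Fin d)) (Fin m), δ / 2 / (q + 1) :=
    Finset.sum_le_sum fun l _ => (hcon _ (lineSize_mem_Icc l)).le
  rw [Finset.sum_const, nsmul_eq_mul, Finset.card_univ, ← hq] at hsum
  have hlt : (q : ℝ) * (δ / 2 / (q + 1)) < δ / 2 := by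
    rw [mul_div_assoc', div_lt_iff₀ (by positivity)]
    nlinarith
  simp only [probReal_univ, smul_eq_mul, one_mul] at hle
  linarith

lemma re_cexp (x : ℝ) : (cexp x).re = Real.cos (2 * Real.pi * x) := by
  rw [cexp, show (2 * Real.pi * x * Complex.I : ℂ) = ((2 * Real.pi * x : ℝ) : ℂ) * Complex.I by
    push_cast; ring]
  exact Complex.exp_ofReal_mul_I_re _

/-- A trigonometric polynomial with positive mean which is positive only in the middle of the
period. -/
lemma trigPoly_nonpos {x : ℝ} (hx : Int.fract x ∉ Set.Icc (1 / 4 : ℝ) (3 / 4)) :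
    1 / 2 - (cexp x).re + (cexp (2 * x)).re / 2 ≤ 0 := by
  rw [re_cexp, re_cexp, show 2 * Real.pi * (2 * x) = 2 * (2 * Real.pi * x) by ring,
    Real.cos_two_mul]
  have hcos : 0 ≤ Real.cos (2 * Real.pi * x) := by
    have hf : Real.cos (2 * Real.pi * x) = Real.cos (2 * Real.pi * Int.fract x) := by
      conv_lhs => rw [← Int.fract_add_floor x]
      rw [mul_add, show 2 * Real.pi * (⌊x⌋ : ℝ) = (⌊x⌋ : ℝ) * (2 * Real.pi) by ring,
        Real.cos_add_int_mul_two_pi]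
    rw [hf]
    have h0 := Int.fract_nonneg x
    have h1 := Int.fract_lt_one x
    have hpi := Real.pi_pos
    rw [Set.mem_Icc, not_and_or, not_le, not_le] at hx
    rcases hx with hx | hx
    · exact Real.cos_nonneg_of_neg_pi_div_two_le_of_le (by nlinarith) (by nlinarith)
    · rw [← Real.cos_sub_two_pi]
      exact Real.cos_nonneg_of_neg_pi_div_two_le_of_le (by nlinarith) (by nlinarith)
  nlinarith [Real.cos_le_one (2 * Real.pi * x)]

/-- A set missing all return times in the middle of the period has small average returns. -/
lemma exists_sum_measure_returnSet_le [IsProbabilityMeasure μ] {T : Fin d → X → X}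
    (hmp : ∀ i, MeasurePreserving (T i) μ μ) (hcomm : ∀ i j, T i ∘ T j = T j ∘ T i)
    {A : Set X} (hA : MeasurableSet A) {β : ℝ} (hβ : Irrational β)
    (h : ∀ n : ℕ, Int.fract (β * (n : ℝ) ^ (d + 1)) ∈ Set.Icc (1 / 4 : ℝ) (3 / 4) →
      μ.real (returnSet T A n) = 0) {ε : ℝ} (hε : 0 < ε) :
    ∃ N₀ : ℕ, ∀ N ≥ N₀, ∑ n ∈ Finset.range N, μ.real (returnSet T A n) ≤ 3 * ε * N := by
  obtain ⟨N₁, hN₁⟩ := exists_norm_sum_cexp_mul_measure_le hmp hcomm hA hβ hε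
  obtain ⟨N₂, hN₂⟩ := exists_norm_sum_cexp_mul_measure_le hmp hcomm hA
    (hβ.natCast_mul two_ne_zero) hε
  refine ⟨max N₁ N₂, fun N hN => ?_⟩
  have h1 := (Complex.abs_re_le_norm _).trans (hN₁ N ((le_max_left _ _).trans hN))
  have h2 := (Complex.abs_re_le_norm _).trans (hN₂ N ((le_max_right _ _).trans hN))
  simp only [Complex.re_sum, Complex.re_mul_ofReal] at h1 h2
  have h3 : ∑ n ∈ Finset.range N, (1 / 2 - (cexp (β * (n : ℝ) ^ (d + 1))).re +
      (cexp (2 * (β * (n : ℝ) ^ (d + 1)))).re / 2) * μ.real (returnSet T A n) ≤ 0 := by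
    refine Finset.sum_nonpos fun n _ => ?_
    by_cases hn : Int.fract (β * (n : ℝ) ^ (d + 1)) ∈ Set.Icc (1 / 4 : ℝ) (3 / 4)
    · rw [h n hn, mul_zero]
    · exact mul_nonpos_of_nonpos_of_nonneg (trigPoly_nonpos hn) measureReal_nonneg
  simp only [add_mul, sub_mul, Finset.sum_add_distrib, Finset.sum_sub_distrib, div_mul_eq_mul_div,
    ← Finset.sum_div, one_mul] at h3
  simp only [Nat.cast_ofNat, mul_assoc] at h2
  have h4 := (abs_le.1 h1).2
  have h5 := (abs_le.1 h2).1
  linarith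

/-- Polynomial Bohr-type sets of degree `d + 1` are sets of recurrence for `d` commuting
transformations. -/
theorem exists_fract_mem_measure_returnSet_pos [IsProbabilityMeasure μ] {T : Fin d → X → X}
    (hmp : ∀ i, MeasurePreserving (T i) μ μ) (hcomm : ∀ i j, T i ∘ T j = T j ∘ T i)
    {A : Set X} (hA : MeasurableSet A) (hApos : 0 < μ A) {α : ℝ} (hα : Irrational α) :
    ∃ n : ℕ, Int.fract (α * (n : ℝ) ^ (d + 1)) ∈ Set.Icc (1 / 4 : ℝ) (3 / 4) ∧
      0 < μ (returnSet T A n) := by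
  by_contra! hcon
  obtain ⟨m, c, hc, hm⟩ := exists_forall_exists_le_measure_returnSet hmp hcomm hA hApos
  have hdecay : ∀ n : ℕ, ∃ N₀ : ℕ, n ∈ Finset.Icc 1 m → ∀ N ≥ N₀,
      ∑ r ∈ Finset.range N, μ.real (returnSet T A (n * r)) ≤ 3 * (c / (4 * (m + 1))) * N := by
    intro n
    by_cases hn : n ∈ Finset.Icc 1 m
    · have hn0 : n ^ (d + 1) ≠ 0 := pow_ne_zero _ (by rw [Finset.mem_Icc] at hn; omega)
      obtain ⟨N₀, hN₀⟩ := exists_sum_measure_returnSet_le (fun i => (hmp i).iterate n)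
        (fun i j => comp_iterate_comm (hcomm i j) n n)
        hA (hα.mul_natCast hn0) (ε := c / (4 * (m + 1))) (fun r hr => by
          rw [returnSet_iterate, measureReal_eq_zero_iff]
          have := hcon (n * r) (by
            convert hr using 2
            push_cast
            ring)
          simpa using this) (by positivity)
      refine ⟨N₀, fun _ N hN => ?_⟩
      simpa only [returnSet_iterate] using hN₀ N hN
    · exact ⟨0, fun h => absurd h hn⟩
  choose N₀ hN₀ using hdecay
  set N := (Finset.Icc 1 m).sup N₀ + 1 with hN
  have hupper : ∑ n ∈ Finset.Icc 1 m, ∑ r ∈ Finset.range N, μ.real (returnSet T A (n * r)) ≤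
      m * (3 * (c / (4 * (m + 1))) * N) := by
    refine (Finset.sum_le_sum fun n hn => hN₀ n hn N
      ((Finset.le_sup (f := N₀) hn).trans (by omega))).trans ?_
    simp
  have hlower : c * N ≤
      ∑ n ∈ Finset.Icc 1 m, ∑ r ∈ Finset.range N, μ.real (returnSet T A (n * r)) := by
    rw [Finset.sum_comm]
    refine le_trans (by simp [mul_comm]) (Finset.sum_le_sum (f := fun _ => c) fun r _ => ?_)
    obtain ⟨n, hn, hnc⟩ := hm r
    exact hnc.trans (Finset.single_le_sum (f := fun n => μ.real (returnSet T A (n * r)))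
      (fun _ _ => measureReal_nonneg) hn)
  have hNpos : (0 : ℝ) < N := by rw [hN]; positivity
  have hlt : m * (3 * (c / (4 * (m + 1))) * N) < c * N := by
    rw [show (m : ℝ) * (3 * (c / (4 * (m + 1))) * N) = (3 * m / (4 * (m + 1))) * (c * N) by
      field_simp]
    refine mul_lt_of_lt_one_left (by positivity) ?_
    rw [div_lt_one (by positivity)]
    have : (0 : ℝ) ≤ m := Nat.cast_nonneg _
    linarith
  linarith

end Recurrence

/-- For `k ≥ 2` and irrational `α`, the set `S_k = {n : {n^k α} ∈ [1/4, 3/4]}` is a set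
of `(k-1)`-recurrence for commuting transformations: whenever `T₁, …, T_{k-1}` are
pairwise commuting measure-preserving transformations of a probability space and `A` is
a measurable set with `μ A > 0`, there exists `n ∈ S_k` with
`μ (A ∩ T₁⁻ⁿA ∩ ⋯ ∩ T_{k-1}⁻ⁿA) > 0`. -/
theorem Sk_recurrence_commuting (k : ℕ) (hk : 2 ≤ k) (α : ℝ) (hα : Irrational α)
    (X : Type*) [MeasurableSpace X] (μ : Measure X) [IsProbabilityMeasure μ]
    (T : Fin (k - 1) → X → X)
    (hmp : ∀ i, MeasurePreserving (T i) μ μ)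
    (hcomm : ∀ i j, T i ∘ T j = T j ∘ T i)
    (A : Set X) (hA : MeasurableSet A) (hApos : 0 < μ A) :
    ∃ n ∈ {m : ℕ | Int.fract ((m : ℝ) ^ k * α) ∈ Set.Icc (1/4 : ℝ) (3/4)},
      0 < μ (A ∩ ⋂ i, (T i)^[n] ⁻¹' A) := by
  obtain ⟨n, hn, hpos⟩ := exists_fract_mem_measure_returnSet_pos hmp hcomm hA hApos hα
  rw [Nat.sub_add_cancel (by omega), mul_comm] at hn
  exact ⟨n, hn, hpos⟩
end

section
/- A set S ⊆ ℕ is k-intersective if and only if it is a set of k-recurrence. -/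
open MeasureTheory Classical

/-- `Λ ⊆ ℤ` has positive upper Banach density:
`limsup_{N-M→∞} |Λ ∩ [M, N)| / (N - M) > 0`, i.e. there is `δ > 0` such that there are
arbitrarily long integer intervals `[M, N)` with `|Λ ∩ [M, N)| ≥ δ (N - M)`. -/
def HasPosUpperBanachDensity (Λ : Set ℤ) : Prop :=
  ∃ δ : ℝ, 0 < δ ∧ ∀ K : ℕ, ∃ M N : ℤ, M + K ≤ N ∧
    δ * ((N : ℝ) - M) ≤ ((Finset.Ico M N).filter (fun x => x ∈ Λ)).card

/-- `S` is `k`-intersective: every `Λ ⊆ ℤ` of positive upper Banach density contains an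
arithmetic progression of length `k+1` whose common difference belongs to `S`. -/
def IsKIntersective (k : ℕ) (S : Set ℕ) : Prop :=
  ∀ Λ : Set ℤ, HasPosUpperBanachDensity Λ →
    ∃ (a : ℤ) (n : ℕ), n ∈ S ∧ ∀ i : ℕ, i ≤ k → a + (i : ℤ) * n ∈ Λ

/-- `S` is a set of `k`-recurrence: for every probability measure-preserving system
`(X, 𝒳, μ, T)` and every measurable `A` with `μ A > 0`, there is `n ∈ S` with
`μ (A ∩ T⁻ⁿA ∩ ⋯ ∩ T⁻ᵏⁿA) > 0`. -/
def IsSetOfKRecurrence (k : ℕ) (S : Set ℕ) : Prop :=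
  ∀ (X : Type) (_ : MeasurableSpace X) (μ : Measure X), IsProbabilityMeasure μ →
    ∀ T : X → X, MeasurePreserving T μ μ →
      ∀ A : Set X, MeasurableSet A → 0 < μ A →
        ∃ n ∈ S, 0 < μ (⋂ i ∈ Finset.range (k + 1), T^[i * n] ⁻¹' A)

open Filter Topology
open scoped ENNReal BoundedContinuousFunction

/-! ### From intersectivity to recurrence -/

/-- If `μ A > 0`, then some point visits `A` along a set of times of positive upper density. -/
theorem MeasureTheory.MeasurePreserving.exists_frequently_visits {X : Type*} [MeasurableSpace X]
    {μ : Measure X} [IsProbabilityMeasure μ] {T : X → X} (hT : MeasurePreserving T μ μ)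
    {A : Set X} (hA : MeasurableSet A) (hpos : 0 < μ A) :
    ∃ x : X, ∃ δ : ℝ, 0 < δ ∧ ∃ᶠ n : ℕ in atTop,
      δ * ((n : ℝ) + 1) ≤ ((Finset.range (n + 1)).filter (fun j => T^[j] x ∈ A)).card := by
  have hmeas (j : ℕ) : MeasurableSet (T^[j] ⁻¹' A) := (hT.measurable.iterate j) hA
  let f (n : ℕ) (x : X) : ℝ≥0∞ :=
    ((n + 1 : ℕ) : ℝ≥0∞)⁻¹ * ∑ j ∈ Finset.range (n + 1), (T^[j] ⁻¹' A).indicator 1 x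
  have hsum (n : ℕ) (x : X) : ∑ j ∈ Finset.range (n + 1), (T^[j] ⁻¹' A).indicator 1 x
      = (((Finset.range (n + 1)).filter (fun j => T^[j] x ∈ A)).card : ℝ≥0∞) := by
    simp [Set.indicator_apply, Finset.sum_boole]
  have hf (n : ℕ) : Measurable (f n) :=
    (Finset.measurable_fun_sum _ fun j _ => measurable_one.indicator (hmeas j)).const_mul _
  have hf_le (n : ℕ) (x : X) : f n x ≤ 1 := by
    simp only [f, hsum]
    rw [← ENNReal.div_eq_inv_mul]
    refine ENNReal.div_le_of_le_mul ?_
    rw [one_mul, Nat.cast_le]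
    exact (Finset.card_filter_le _ _).trans (by simp)
  have hint (n : ℕ) : ∫⁻ x, f n x ∂μ = μ A := by
    simp only [f]
    rw [lintegral_const_mul _
        (Finset.measurable_fun_sum _ fun j _ => measurable_one.indicator (hmeas j)),
      lintegral_finsetSum _ fun j _ => measurable_one.indicator (hmeas j)]
    simp only [lintegral_indicator_one (hmeas _),
      (hT.iterate _).measure_preimage hA.nullMeasurableSet]
    rw [Finset.sum_const, Finset.card_range, nsmul_eq_mul, ← mul_assoc,
      ENNReal.inv_mul_cancel (by simp) (by simp), one_mul]
  have hlim_le : ∫⁻ x, limsup (f · x) atTop ∂μ ≤ 1 := by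
    calc ∫⁻ x, limsup (f · x) atTop ∂μ ≤ ∫⁻ _, 1 ∂μ :=
          lintegral_mono fun x => limsup_le_of_le (h := Eventually.of_forall fun n => hf_le n x)
      _ = 1 := by simp
  obtain ⟨x, hx⟩ := exists_lintegral_le (μ := μ) (ne_top_of_le_ne_top ENNReal.one_ne_top hlim_le)
  have hAx : μ A ≤ limsup (f · x) atTop := by
    refine le_trans ?_ hx
    refine le_trans ?_ (limsup_lintegral_le 1 hf (fun n => ae_of_all _ (hf_le n)) (by simp))
    simp [hint]
  have hfin : μ A ≠ ∞ := measure_ne_top μ A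
  refine ⟨x, (μ A / 2).toReal, ENNReal.toReal_pos (ENNReal.half_pos hpos.ne').ne'
    (ENNReal.div_ne_top hfin two_ne_zero), ?_⟩
  refine (frequently_lt_of_lt_limsup (h := (ENNReal.half_lt_self hpos.ne' hfin).trans_le hAx)).mono
    fun n hn => ?_
  simp only [f, hsum] at hn
  rw [← ENNReal.div_eq_inv_mul, ENNReal.lt_div_iff_mul_lt (by simp) (by simp)] at hn
  have := ENNReal.toReal_mono (by simp) hn.le
  rw [ENNReal.toReal_mul, ENNReal.toReal_natCast, ENNReal.toReal_natCast] at this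
  exact_mod_cast this

theorem IsKIntersective.isSetOfKRecurrence {k : ℕ} {S : Set ℕ} (h : IsKIntersective k S) :
    IsSetOfKRecurrence k S := by
  intro X _ μ _ T hT A hA hpos
  by_contra! hnull
  let R (n : ℕ) : Set X := ⋂ i ∈ Finset.range (k + 1), T^[i * n] ⁻¹' A
  have hR (n : ℕ) : MeasurableSet (R n) :=
    Finset.measurableSet_biInter _ fun i _ => (hT.measurable.iterate _) hA
  let B : Set X := ⋃ n ∈ S, R n
  have hB : MeasurableSet B := MeasurableSet.biUnion S.to_countable fun n _ => hR n
  have hB0 : μ B = 0 :=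
    (measure_biUnion_null_iff S.to_countable).2 fun n hn => le_antisymm (hnull n hn) bot_le
  obtain ⟨x, δ, hδ, hfreq⟩ := hT.exists_frequently_visits (hA.diff hB)
    (by rwa [measure_sdiff_null hB0])
  let Λ : Set ℤ := {a | ∃ m : ℕ, a = m ∧ T^[m] x ∈ A \ B}
  have hΛ : HasPosUpperBanachDensity Λ := by
    refine ⟨δ, hδ, fun K => ?_⟩
    obtain ⟨n, hKn, hn⟩ := frequently_atTop.1 hfreq K
    refine ⟨0, (n : ℤ) + 1, by omega, ?_⟩
    push_cast
    rw [sub_zero]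
    refine hn.trans (Nat.cast_le.2 ?_)
    refine Finset.card_le_card_of_injOn (fun j : ℕ => (j : ℤ)) (fun j hj => ?_)
      Nat.cast_injective.injOn
    simp only [Finset.coe_filter, Finset.mem_range, Finset.mem_Ico, Set.mem_ofPred_eq] at hj ⊢
    exact ⟨by omega, j, rfl, hj.2⟩
  obtain ⟨a, n, hnS, hprog⟩ := h Λ hΛ
  obtain ⟨m, ham, hm⟩ := hprog 0 (Nat.zero_le k)
  refine hm.2 (Set.mem_biUnion hnS (Set.mem_iInter₂.2 fun i hi => ?_))
  obtain ⟨l, hal, hl⟩ := hprog i (Nat.lt_succ_iff.1 (Finset.mem_range.1 hi))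
  have hlm : l = i * n + m := by
    zify
    rw [← hal]
    simp at ham
    omega
  rw [Set.mem_preimage, ← Function.iterate_add_apply, ← hlm]
  exact hl.1

/-! ### From recurrence to intersectivity -/

/-- The uniform average of the Dirac masses at the points `g a`, `a ∈ s`. -/
noncomputable def empiricalMeasure {ι X : Type*} [MeasurableSpace X] (g : ι → X) (s : Finset ι)
    (hs : s.Nonempty) : ProbabilityMeasure X :=
  ⟨(s.card : ℝ≥0∞)⁻¹ • ∑ a ∈ s, Measure.dirac (g a), ⟨by
    simp [ENNReal.inv_mul_cancel, hs.card_ne_zero]⟩⟩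

theorem integral_empiricalMeasure {ι X : Type*} [MeasurableSpace X] [TopologicalSpace X]
    [OpensMeasurableSpace X] (g : ι → X) (s : Finset ι) (hs : s.Nonempty) (f : X →ᵇ ℝ) :
    ∫ x, f x ∂(empiricalMeasure g s hs : Measure X) = (s.card : ℝ)⁻¹ * ∑ a ∈ s, f (g a) := by
  have hf (ν : Measure X) [IsFiniteMeasure ν] : Integrable f ν := f.integrable ν
  simp only [empiricalMeasure, ProbabilityMeasure.coe_mk]
  rw [integral_smul_measure, integral_finsetSum_measure fun a _ => hf _]
  simp [integral_dirac' _ _ f.continuous.stronglyMeasurable]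

theorem empiricalMeasure_apply {ι X : Type*} [MeasurableSpace X] (g : ι → X) (s : Finset ι)
    (hs : s.Nonempty) {E : Set X} (hE : MeasurableSet E) :
    (empiricalMeasure g s hs E : ℝ) = (s.filter (fun a => g a ∈ E)).card / (s.card : ℝ) := by
  rw [ProbabilityMeasure.coeFn_def]
  simp [empiricalMeasure, hE, Set.indicator_apply, div_eq_inv_mul]

theorem sum_Ico_int_succ_sub_sum {G : Type*} [AddCommGroup G] (u : ℤ → G) {M N : ℤ} (h : M ≤ N) :
    ∑ a ∈ Finset.Ico M N, u (a + 1) - ∑ a ∈ Finset.Ico M N, u a = u N - u M := by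
  induction N, h using Int.leInduction with
  | base => simp
  | succ N h ih =>
    rw [← Finset.insert_Ico_right_eq_Ico_add_one h, Finset.sum_insert (by simp),
      Finset.sum_insert (by simp), add_sub_add_comm, ih]
    abel

/-- Empirical measures along longer and longer orbit segments of a continuous map accumulate at an
invariant measure. -/
theorem exists_measurePreserving_tendsto_empirical {X : Type*} [TopologicalSpace X]
    [CompactSpace X] [T2Space X] [MeasurableSpace X] [BorelSpace X] [HasOuterApproxClosed X]
    {T : X → X} (hT : Continuous T) {g : ℤ → X} (hg : ∀ a, T (g a) = g (a + 1))
    {M N : ℕ → ℤ} (hMN : ∀ K : ℕ, M K + (K + 1 : ℕ) ≤ N K) :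
    ∃ (μ : ProbabilityMeasure X) (U : Ultrafilter ℕ),
      MeasurePreserving T (μ : Measure X) (μ : Measure X) ∧
      ∀ E : Set X, IsClopen E → Tendsto
        (fun K => (((Finset.Ico (M K) (N K)).filter (fun a => g a ∈ E)).card : ℝ) /
          ((N K : ℝ) - M K)) U (𝓝 (μ E : ℝ)) := by
  have hlt (K : ℕ) : M K < N K := by have := hMN K; omega
  have hcard (K : ℕ) : ((Finset.Ico (M K) (N K)).card : ℝ) = (N K : ℝ) - M K := by
    rw [Int.card_Ico, ← Int.cast_natCast, Int.toNat_of_nonneg (by have := hlt K; omega)]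
    push_cast
    rfl
  let ν (K : ℕ) : ProbabilityMeasure X :=
    empiricalMeasure g (Finset.Ico (M K) (N K)) (Finset.nonempty_Ico.2 (hlt K))
  let U : Ultrafilter ℕ := hyperfilter ℕ
  have hU : (U : Filter ℕ) ≤ atTop := Nat.hyperfilter_le_atTop
  obtain ⟨μ, hμ⟩ : ∃ μ, Tendsto ν U (𝓝 μ) :=
    ⟨(U.map ν).lim, by simpa [Tendsto] using! (U.map ν).le_nhds_lim⟩
  refine ⟨μ, U, ⟨hT.measurable, ?_⟩, fun E hE => ?_⟩
  · have hmap : Tendsto ν U (𝓝 (μ.map hT.measurable.aemeasurable)) := by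
      refine ProbabilityMeasure.tendsto_iff_forall_integral_tendsto.2 fun f => ?_
      have hfT := ProbabilityMeasure.tendsto_iff_forall_integral_tendsto.1 hμ
        (f.compContinuous ⟨T, hT⟩)
      rw [ProbabilityMeasure.toMeasure_map, integral_map hT.measurable.aemeasurable
        f.continuous.aestronglyMeasurable]
      refine hfT.congr_dist ?_
      have hbound : Tendsto (fun K : ℕ => 2 * ‖f‖ * (1 / ((K : ℝ) + 1))) U (𝓝 0) := by
        simpa using (tendsto_one_div_add_atTop_nhds_zero_nat.mono_left hU).const_mul (2 * ‖f‖)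
      refine squeeze_zero (fun _ => dist_nonneg) (fun K => ?_) hbound
      simp only [ν, integral_empiricalMeasure]
      rw [Real.dist_eq, ← mul_sub, hcard]
      simp only [BoundedContinuousFunction.compContinuous_apply, ContinuousMap.coe_mk, hg]
      rw [sum_Ico_int_succ_sub_sum (fun a => f (g a)) (hlt K).le, abs_mul]
      have hK : (K : ℝ) + 1 ≤ (N K : ℝ) - M K := by
        have : ((M K + (K + 1 : ℕ) : ℤ) : ℝ) ≤ N K := Int.cast_le.2 (hMN K)
        push_cast at this
        linarith
      have hK0 : (0 : ℝ) < (K : ℝ) + 1 := by positivity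
      rw [abs_of_nonneg (inv_nonneg.2 (hK0.le.trans hK)), mul_comm]
      refine mul_le_mul ?_ ?_ (inv_nonneg.2 (hK0.le.trans hK)) (by positivity)
      · exact f.dist_le_two_norm (g (N K)) (g (M K))
      · rw [← one_div]
        exact one_div_le_one_div_of_le hK0 hK
    have := tendsto_nhds_unique hmap hμ
    rw [← ProbabilityMeasure.toMeasure_map μ hT.measurable.aemeasurable, this]
  · have := (NNReal.continuous_coe.tendsto _).comp
      (ProbabilityMeasure.tendsto_measure_of_isClopen_of_tendsto hμ hE)
    refine this.congr fun K => ?_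
    simp only [Function.comp_apply, ν]
    rw [empiricalMeasure_apply _ _ _ hE.isOpen.measurableSet, hcard]

theorem IsSetOfKRecurrence.isKIntersective {k : ℕ} {S : Set ℕ} (h : IsSetOfKRecurrence k S) :
    IsKIntersective k S := by
  rintro Λ ⟨δ, hδ, hdens⟩
  choose M N hMN hcard using fun K : ℕ => hdens (K + 1)
  let T (x : ℤ → Bool) (j : ℤ) : Bool := x (j + 1)
  have hT : Continuous T := by fun_prop
  let g (a j : ℤ) : Bool := decide (a + j ∈ Λ)
  have hg (a : ℤ) : T (g a) = g (a + 1) := by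
    ext j
    simp [T, g, add_assoc, add_comm j]
  have hgiter (n : ℕ) (a : ℤ) : T^[n] (g a) = g (a + n) := by
    induction n with
    | zero => simp
    | succ n ih => rw [Function.iterate_succ_apply', ih, hg]; push_cast; rw [add_assoc]
  let A : Set (ℤ → Bool) := {x | x 0 = true}
  have hA : IsClopen A := (isClopen_discrete {true}).preimage (continuous_apply (0 : ℤ))
  have hgA (a : ℤ) : g a ∈ A ↔ a ∈ Λ := by simp [g, A]
  obtain ⟨μ, U, hTμ, hlim⟩ := exists_measurePreserving_tendsto_empirical hT hg hMN
  have hAδ : δ ≤ μ A := by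
    refine ge_of_tendsto' (hlim A hA) fun K => ?_
    have hlt : (0 : ℝ) < (N K : ℝ) - M K := by
      have : M K < N K := by have := hMN K; omega
      exact sub_pos.2 (Int.cast_lt.2 this)
    rw [le_div_iff₀ hlt]
    simpa only [hgA] using hcard K
  have hApos : 0 < (μ : Measure (ℤ → Bool)) A := by
    rw [← ProbabilityMeasure.ennreal_coeFn_eq_coeFn_toMeasure, ENNReal.coe_pos, ← NNReal.coe_pos]
    exact hδ.trans_le hAδ
  obtain ⟨n, hnS, hn⟩ := h (ℤ → Bool) _ μ inferInstance T hTμ A hA.isOpen.measurableSet hApos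
  let E : Set (ℤ → Bool) := ⋂ i ∈ Finset.range (k + 1), T^[i * n] ⁻¹' A
  have hE : IsClopen E := isClopen_biInter_finset fun i _ => hA.preimage (hT.iterate _)
  have hEpos : (0 : ℝ) < μ E := by
    rwa [NNReal.coe_pos, ← ENNReal.coe_pos, ProbabilityMeasure.ennreal_coeFn_eq_coeFn_toMeasure]
  obtain ⟨K, hK⟩ := ((hlim E hE).eventually_const_lt hEpos).exists
  have hne : ((Finset.Ico (M K) (N K)).filter (fun a => g a ∈ E)).Nonempty := by
    rw [← Finset.card_pos]
    by_contra h0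
    simp [Nat.eq_zero_of_not_pos h0] at hK
  obtain ⟨a, ha⟩ := hne
  refine ⟨a, n, hnS, fun i hi => ?_⟩
  have := Set.mem_iInter₂.1 (Finset.mem_filter.1 ha).2 i (Finset.mem_range.2 (Nat.lt_succ_of_le hi))
  rw [Set.mem_preimage, hgiter, hgA] at this
  simpa using this

/-- A set `S ⊆ ℕ` is `k`-intersective if and only if it is a set of `k`-recurrence. -/
theorem kIntersective_iff_kRecurrence (k : ℕ) (S : Set ℕ) :
    IsKIntersective k S ↔ IsSetOfKRecurrence k S :=
  ⟨IsKIntersective.isSetOfKRecurrence, IsSetOfKRecurrence.isKIntersective⟩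
end
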